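/- arXiv:1511.02982 — 2 statements merged into one kernel-verified Lean document; each statement's English description precedes it below -/
import Mathlib

section
/- Let X be a zero set for the ball algebra A(𝔹_d) and let X_0 = X ∩ 𝕊_d. Define X̂_0 to be the union of X_0 with the set of all points λ ∈ 𝔹_d which have a representing measure supported on X_0. Then X̂_0 is a zero set for A(𝔹_d) containing X_0, and every zero set for A(𝔹_d) containing X_0 contains X̂_0; that is, X̂_0 is the smallest zero set for A(𝔹_d) containing X_0. -/
open MeasureTheory Metric Set Filter Topology

noncomputable section

abbrev CB (d : ℕ) : Set (EuclideanSpace ℂ (Fin d)) := Metric.closedBall 0 1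

instance (d : ℕ) : CompactSpace (CB d) :=
  isCompact_iff_compactSpace.mp (isCompact_closedBall _ _)

instance (d : ℕ) : MeasurableSpace (EuclideanSpace ℂ (Fin d)) := borel _

instance (d : ℕ) : BorelSpace (EuclideanSpace ℂ (Fin d)) := ⟨rfl⟩

def polyAlg (d : ℕ) : Subalgebra ℂ C(CB d, ℂ) :=
  Algebra.adjoin ℂ
    { f : C(CB d, ℂ) | ∃ i : Fin d,
        f = ⟨fun z => (z : EuclideanSpace ℂ (Fin d)) i,
             (EuclideanSpace.proj (𝕜 := ℂ) i).continuous.comp continuous_subtype_val⟩ }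

def ballAlgSub (d : ℕ) : Subalgebra ℂ C(CB d, ℂ) := (polyAlg d).topologicalClosure

def ballAlg (d : ℕ) : Set C(CB d, ℂ) := ballAlgSub d

def sphereD (d : ℕ) : Set (CB d) := {z | ‖(z : EuclideanSpace ℂ (Fin d))‖ = 1}

def openD (d : ℕ) : Set (CB d) := {z | ‖(z : EuclideanSpace ℂ (Fin d))‖ < 1}

def ZS (d : ℕ) (S : Set C(CB d, ℂ)) : Set (CB d) := {z | ∀ φ ∈ S, φ z = 0}

def IX (d : ℕ) (X : Set (CB d)) : Set C(CB d, ℂ) :=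
  {φ | φ ∈ ballAlg d ∧ ∀ z ∈ X, φ z = 0}

def IsZeroSet (d : ℕ) (X : Set (CB d)) : Prop :=
  ∃ S ⊆ ballAlg d, X = ZS d S

/-- A representing measure for a point of the closed ball: a finite positive regular
Borel measure integrating every function of the ball algebra to its value at the point. -/
def IsRepMeasure (d : ℕ) (lam : CB d) (μ : Measure (CB d)) : Prop :=
  IsFiniteMeasure μ ∧ μ.Regular ∧ ∀ φ ∈ ballAlg d, φ lam = ∫ z, φ z ∂μ

/-- `X̂₀` : `X₀` together with all points of the open ball having a representing measure
supported on `X₀`. -/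
def hatSet (d : ℕ) (X0 : Set (CB d)) : Set (CB d) :=
  X0 ∪ {lam | lam ∈ openD d ∧
    ∃ μ : Measure (CB d), IsRepMeasure d lam μ ∧ μ X0ᶜ = 0}

/-- `z` is an isolated point of the set `A`. -/
def IsIsolatedIn (d : ℕ) (A : Set (CB d)) (z : CB d) : Prop :=
  z ∈ A ∧ ∃ U : Set (CB d), IsOpen U ∧ U ∩ A = {z}

/-- A closed ideal of the ball algebra. -/
structure IsClosedIdeal (d : ℕ) (J : Set C(CB d, ℂ)) : Prop where
  subset : J ⊆ ballAlg d
  closed : IsClosed J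
  zero_mem : (0 : C(CB d, ℂ)) ∈ J
  add_mem : ∀ f ∈ J, ∀ g ∈ J, f + g ∈ J
  smul_mem : ∀ (c : ℂ), ∀ f ∈ J, c • f ∈ J
  mul_mem : ∀ f ∈ ballAlg d, ∀ g ∈ J, f * g ∈ J

/-- An `A(𝔹_d)`-Henkin (finite positive regular Borel) measure on the sphere. -/
def IsHenkin (d : ℕ) (μ : Measure (CB d)) : Prop :=
  IsFiniteMeasure μ ∧ μ.Regular ∧ μ (sphereD d)ᶜ = 0 ∧
    ∀ f : ℕ → C(CB d, ℂ), (∀ n, f n ∈ ballAlg d) → (∃ C : ℝ, ∀ n, ‖f n‖ ≤ C) →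
      (∀ z ∈ openD d, Tendsto (fun n => f n z) atTop (𝓝 0)) →
      Tendsto (fun n => ∫ z, f n z ∂μ) atTop (𝓝 0)

/-- An `A(𝔹_d)`-totally null subset of the sphere. -/
def IsTotallyNull (d : ℕ) (K : Set (CB d)) : Prop :=
  K ⊆ sphereD d ∧ ∀ μ : Measure (CB d), IsHenkin d μ → μ K = 0

/-- A complex regular Borel measure on the sphere, given by its polar decomposition:
total variation `var` (a finite positive regular Borel measure concentrated on the
sphere) and a unimodular density. -/
structure CMeasure (d : ℕ) where
  var : Measure (CB d)
  density : CB d → ℂ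
  finite : IsFiniteMeasure var
  regular : var.Regular
  measurable_density : Measurable density
  norm_density : ∀ z, ‖density z‖ = 1
  onSphere : var (sphereD d)ᶜ = 0

/-- Integral of a continuous function against a complex measure. -/
def cInt (d : ℕ) (μ : CMeasure d) (φ : C(CB d, ℂ)) : ℂ :=
  ∫ z, φ z * μ.density z ∂μ.var

/-- An `A(𝔹_d)`-Henkin complex measure on the sphere. -/
def IsHenkinC (d : ℕ) (μ : CMeasure d) : Prop :=
  ∀ f : ℕ → C(CB d, ℂ), (∀ n, f n ∈ ballAlg d) → (∃ C : ℝ, ∀ n, ‖f n‖ ≤ C) →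
    (∀ z ∈ openD d, Tendsto (fun n => f n z) atTop (𝓝 0)) →
    Tendsto (fun n => cInt d μ (f n)) atTop (𝓝 0)

/-- An `A(𝔹_d)`-totally singular complex measure: its total variation is mutually
singular with that of every Henkin complex measure. -/
def IsTotallySingularC (d : ℕ) (μ : CMeasure d) : Prop :=
  ∀ ν : CMeasure d, IsHenkinC d ν → μ.var ⟂ₘ ν.var

/-- An `A(𝔹_d)`-totally null Borel subset of the sphere (complex-measure version). -/
def IsTotallyNullC (d : ℕ) (K : Set (CB d)) : Prop :=
  K ⊆ sphereD d ∧ ∀ μ : CMeasure d, IsHenkinC d μ → μ.var K = 0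

def polyEval {d : ℕ} (P : MvPolynomial (Fin d) ℂ) (x : EuclideanSpace ℂ (Fin d)) : ℂ :=
  MvPolynomial.eval (fun i => x i) P

def polyFDeriv {d : ℕ} (P : MvPolynomial (Fin d) ℂ) (x : EuclideanSpace ℂ (Fin d)) :
    EuclideanSpace ℂ (Fin d) →L[ℂ] ℂ :=
  ∑ j, polyEval (MvPolynomial.pderiv j P) x • EuclideanSpace.proj (𝕜 := ℂ) j

lemma polyFDeriv_apply {d : ℕ} (P : MvPolynomial (Fin d) ℂ) (x v : EuclideanSpace ℂ (Fin d)) :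
    polyFDeriv P x v = ∑ j, polyEval (MvPolynomial.pderiv j P) x * v j := by
  simp [polyFDeriv]

lemma hasFDerivAt_polyEval {d : ℕ} (P : MvPolynomial (Fin d) ℂ)
    (x : EuclideanSpace ℂ (Fin d)) : HasFDerivAt (polyEval P) (polyFDeriv P x) x := by
  induction P using MvPolynomial.induction_on with
  | C a =>
    have h1 : polyEval (MvPolynomial.C a : MvPolynomial (Fin d) ℂ) = fun _ => a := by
      ext y; simp [polyEval]
    have h2 : polyFDeriv (MvPolynomial.C a) x = 0 := by
      ext v; simp [polyFDeriv_apply, polyEval]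
    rw [h1, h2]
    exact hasFDerivAt_const _ _
  | add P Q hP hQ =>
    have h1 : polyEval (P + Q) = fun y => polyEval P y + polyEval Q y := by
      ext y; simp [polyEval]
    have h2 : polyFDeriv (P + Q) x = polyFDeriv P x + polyFDeriv Q x := by
      ext v
      simp [polyFDeriv_apply, polyEval, add_mul, Finset.sum_add_distrib]
    rw [h1, h2]
    exact hP.add hQ
  | mul_X P n hP =>
    have h1 : polyEval (P * MvPolynomial.X n) = fun y => polyEval P y * y n := by
      ext y; simp [polyEval]
    have h2 : polyFDeriv (P * MvPolynomial.X n) x =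
        polyEval P x • EuclideanSpace.proj (𝕜 := ℂ) n + x n • polyFDeriv P x := by
      ext v
      simp only [polyFDeriv_apply, polyEval, Derivation.leibniz, MvPolynomial.pderiv_X,
        add_apply, smul_apply, smul_eq_mul, map_add,
        map_mul, MvPolynomial.eval_X, add_mul, Finset.sum_add_distrib, Finset.mul_sum,
        PiLp.proj_apply]
      congr 1
      · rw [Finset.sum_eq_single n]
        · simp
        · intro b _ hb
          simp [Ne.symm hb]
        · simp
      · exact Finset.sum_congr rfl fun j _ => by ring
    rw [h1, h2]
    exact hP.mul (EuclideanSpace.proj (𝕜 := ℂ) n).hasFDerivAt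

lemma continuous_polyEval {d : ℕ} (P : MvPolynomial (Fin d) ℂ) : Continuous (polyEval P) :=
  continuous_iff_continuousAt.2 fun x => (hasFDerivAt_polyEval P x).continuousAt

lemma norm_polyFDeriv_apply_le {d : ℕ} {P : MvPolynomial (Fin d) ℂ} {M R : ℝ} (hR : 0 < R)
    (hP : ∀ x : EuclideanSpace ℂ (Fin d), ‖x‖ ≤ 1 → ‖polyEval P x‖ ≤ M)
    {x v : EuclideanSpace ℂ (Fin d)} (hx : ∀ s : ℂ, ‖s‖ = R → ‖x + s • v‖ ≤ 1) :
    ‖polyFDeriv P x v‖ ≤ M / R := by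
  have hline : ∀ s : ℂ, HasDerivAt (fun s : ℂ => x + s • v) v s := fun s => by
    simpa using ((hasDerivAt_id s).smul_const v).const_add x
  have hder : ∀ s : ℂ, HasDerivAt (fun s : ℂ => polyEval P (x + s • v))
      (polyFDeriv P (x + s • v) v) s := fun s =>
    (hasFDerivAt_polyEval P (x + s • v)).comp_hasDerivAt (f := fun s : ℂ => x + s • v) s (hline s)
  have h := Complex.norm_deriv_le_of_forall_mem_sphere_norm_le (c := 0) (C := M)
    (f := fun s : ℂ => polyEval P (x + s • v)) hR
    (Differentiable.diffContOnCl fun s => (hder s).differentiableAt)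
    (fun s hs => hP _ (hx s (by simpa using hs)))
  simpa [(hder 0).deriv] using h

/-- Radial averaging: every polynomial `R` is the radial derivative of `t ↦ t N(tz)`. -/
lemma exists_radial_primitive {d : ℕ} (R : MvPolynomial (Fin d) ℂ) :
    ∃ N : ℝ → MvPolynomial (Fin d) ℂ, ∀ (z : EuclideanSpace ℂ (Fin d)) (t : ℝ),
      HasDerivAt (fun t : ℝ => polyEval (N t) z) (polyEval R ((t : ℂ) • z)) t := by
  induction R using MvPolynomial.induction_on' with
  | monomial u a =>
    refine ⟨fun t => MvPolynomial.monomial u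
      (a * ((((∑ i, u i : ℕ) : ℂ) + 1)⁻¹ * (t : ℂ) ^ ((∑ i, u i) + 1))), fun z t => ?_⟩
    have hm : ∀ (b : ℂ) (y : EuclideanSpace ℂ (Fin d)),
        polyEval (MvPolynomial.monomial u b) y = b * ∏ i, y i ^ u i := by
      intro b y
      simp [polyEval, MvPolynomial.eval_monomial, Finsupp.prod_fintype]
    simp only [hm]
    have hne : (((∑ i, u i : ℕ) : ℂ) + 1) ≠ 0 := Nat.cast_add_one_ne_zero _
    have h := ((((hasDerivAt_id t).ofReal_comp).pow ((∑ i, u i) + 1)).const_mul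
      ((((∑ i, u i : ℕ) : ℂ) + 1)⁻¹)).const_mul a |>.mul_const (∏ i, z i ^ u i)
    refine h.congr_deriv ?_
    simp only [PiLp.smul_apply, smul_eq_mul, mul_pow, Finset.prod_mul_distrib,
      Finset.prod_pow_eq_pow_sum]
    push_cast at hne ⊢
    simp
    field_simp
  | add P Q hP hQ =>
    obtain ⟨N, hN⟩ := hP
    obtain ⟨N', hN'⟩ := hQ
    refine ⟨fun t => N t + N' t, fun z t => ?_⟩
    have := (hN z t).add (hN' z t)
    simpa [polyEval, Pi.add_def] using this

lemma hasDerivAt_polyEval_ofReal_smul {d : ℕ} (P : MvPolynomial (Fin d) ℂ)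
    (z : EuclideanSpace ℂ (Fin d)) (t : ℝ) :
    HasDerivAt (fun t : ℝ => polyEval P ((t : ℂ) • z)) (polyFDeriv P ((t : ℂ) • z) z) t := by
  have hline : HasDerivAt (fun s : ℂ => s • z) z (t : ℂ) := by
    simpa using (hasDerivAt_id (t : ℂ)).smul_const z
  exact ((hasFDerivAt_polyEval P ((t : ℂ) • z)).comp_hasDerivAt
    (f := fun s : ℂ => s • z) (t : ℂ) hline).comp_ofReal

/-- Up to an error `O(√(1-s))`, the product of `conj zᵢ` with `P(z) - P(sz)` is a polynomial on the
sphere. -/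
lemma exists_poly_conj_mul_sub {d : ℕ} (i : Fin d) {P : MvPolynomial (Fin d) ℂ} {M s : ℝ}
    (hs0 : 0 ≤ s) (hs1 : s < 1)
    (hP : ∀ x : EuclideanSpace ℂ (Fin d), ‖x‖ ≤ 1 → ‖polyEval P x‖ ≤ M) :
    ∃ G : MvPolynomial (Fin d) ℂ, ∀ z : EuclideanSpace ℂ (Fin d), ‖z‖ = 1 →
      ‖star (z i) * (polyEval P z - polyEval P ((s : ℂ) • z)) - polyEval G z‖
        ≤ 2 * M * √(1 - s) := by
  obtain ⟨N, hN⟩ := exists_radial_primitive (MvPolynomial.pderiv i P)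
  refine ⟨N 1 - N s, fun z hz => ?_⟩
  have hM : 0 ≤ M := (norm_nonneg _).trans (hP 0 (by simp))
  set e : EuclideanSpace ℂ (Fin d) := EuclideanSpace.single i 1 with he
  set τ : EuclideanSpace ℂ (Fin d) := star (z i) • z - e with hτ
  have hDe : ∀ x, polyFDeriv P x e = polyEval (MvPolynomial.pderiv i P) x := by
    intro x
    rw [polyFDeriv_apply, Finset.sum_eq_single i]
    · simp [he]
    · intro b _ hb
      simp [he, hb]
    · simp
  have horth : inner ℂ z τ = 0 := by
    rw [hτ, inner_sub_right, inner_smul_right, inner_self_eq_norm_sq_to_K, hz, he,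
      EuclideanSpace.inner_single_right]
    simp
  have hnorm : ∀ a b : ℂ, ‖a • z + b • τ‖ ^ 2 = ‖a‖ ^ 2 + ‖b‖ ^ 2 * ‖τ‖ ^ 2 := by
    intro a b
    have h0 : inner ℂ (a • z) (b • τ) = 0 := by
      rw [inner_smul_left, inner_smul_right, horth]; simp
    have := norm_add_sq_eq_norm_sq_add_norm_sq_of_inner_eq_zero (𝕜 := ℂ) (a • z) (b • τ) h0
    rw [norm_smul, norm_smul, hz] at this
    nlinarith
  have hτ1 : ‖τ‖ ^ 2 ≤ 1 := by
    have h1 : e = star (z i) • z + (-1 : ℂ) • τ := by rw [hτ]; module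
    have h2 := hnorm (star (z i)) (-1)
    rw [← h1] at h2
    have h3 : ‖e‖ = 1 := by simp [he]
    rw [h3] at h2
    simp at h2
    nlinarith [sq_nonneg ‖z i‖]
  set f : ℝ → ℂ := fun t => star (z i) * (polyEval P ((t : ℂ) • z) - polyEval P ((s : ℂ) • z))
    - (polyEval (N t) z - polyEval (N s) z) with hf
  have hder : ∀ t : ℝ, HasDerivAt f (polyFDeriv P ((t : ℂ) • z) τ) t := by
    intro t
    have := (((hasDerivAt_polyEval_ofReal_smul P z t).sub_const
      (polyEval P ((s : ℂ) • z))).const_mul (star (z i))).sub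
      ((hN z t).sub_const (polyEval (N s) z))
    refine this.congr_deriv ?_
    rw [hτ, map_sub, map_smul, hDe, smul_eq_mul]
  set B : ℝ → ℝ := fun t => 2 * M * (√(1 - s) - √(1 - t)) with hB
  have hBder : ∀ t ∈ Ico s 1, HasDerivAt B (M / √(1 - t)) t := by
    intro t ht
    have h1 : (1 - t) ≠ 0 := by linarith [ht.2]
    have h2 := (((hasDerivAt_id t).const_sub 1).sqrt h1).const_sub (√(1 - s))
      |>.const_mul (2 * M)
    refine h2.congr_deriv ?_
    have : √(1 - t) ≠ 0 := (Real.sqrt_pos.2 (by linarith [ht.2])).ne'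
    simp only [id]
    field_simp
  have hmain := image_norm_le_of_norm_deriv_right_le_deriv_boundary' (f := f) (a := s) (b := 1)
    (f' := fun t => polyFDeriv P ((t : ℂ) • z) τ)
    (fun t _ => (hder t).continuousAt.continuousWithinAt)
    (fun t _ => (hder t).hasDerivWithinAt)
    (B := B) (B' := fun t => M / √(1 - t)) (by simp [hf, hB])
    (by fun_prop)
    (fun t ht => (hBder t ht).hasDerivWithinAt)
    (fun t ht => norm_polyFDeriv_apply_le (Real.sqrt_pos.2 (by linarith [ht.2])) hP
      (fun w hw => by
        have h1 := hnorm (t : ℂ) w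
        have h2 : ‖w‖ ^ 2 = 1 - t := by
          rw [hw, Real.sq_sqrt (by linarith [ht.2])]
        have h3 : ‖(t : ℂ)‖ ^ 2 = t ^ 2 := by simp
        have ht0 : 0 ≤ t := hs0.trans ht.1
        have ht1 := ht.2
        rw [h2, h3] at h1
        have h4 : ‖(t : ℂ) • z + w • τ‖ ^ 2 ≤ 1 := by nlinarith
        nlinarith [norm_nonneg ((t : ℂ) • z + w • τ)]))
    (right_mem_Icc.2 hs1.le)
  simpa [hf, hB, polyEval] using hmain

lemma norm_polyEval_smul_sub_le {d : ℕ} {P : MvPolynomial (Fin d) ℂ} {M s : ℝ}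
    (hs0 : 0 ≤ s) (hs1 : s < 1)
    (hP : ∀ x : EuclideanSpace ℂ (Fin d), ‖x‖ ≤ 1 → ‖polyEval P x‖ ≤ M)
    {z w : EuclideanSpace ℂ (Fin d)} (hz : ‖z‖ ≤ 1) (hw : ‖w‖ ≤ 1) :
    ‖polyEval P ((s : ℂ) • z) - polyEval P ((s : ℂ) • w)‖ ≤ M / (1 - s) * ‖z - w‖ := by
  have hM : 0 ≤ M := (norm_nonneg _).trans (hP 0 (by simp))
  have h1s : 0 < 1 - s := by linarith
  have hbound : ∀ x ∈ closedBall (0 : EuclideanSpace ℂ (Fin d)) s,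
      ‖polyFDeriv P x‖ ≤ M / (1 - s) := by
    intro x hx
    refine ContinuousLinearMap.opNorm_le_bound _ (by positivity) fun v => ?_
    rcases eq_or_ne v 0 with rfl | hv
    · simp
    have hv' : 0 < ‖v‖ := norm_pos_iff.2 hv
    have h := norm_polyFDeriv_apply_le (P := P) (M := M) (R := (1 - s) / ‖v‖) (by positivity) hP
      (x := x) (v := v) (fun c hc => by
        refine (norm_add_le _ _).trans ?_
        rw [norm_smul, hc, div_mul_cancel₀ _ hv'.ne']
        have := mem_closedBall_zero_iff.1 hx
        linarith)
    refine h.trans (le_of_eq ?_)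
    field_simp
  have hmem : ∀ {y : EuclideanSpace ℂ (Fin d)}, ‖y‖ ≤ 1 →
      (s : ℂ) • y ∈ closedBall (0 : EuclideanSpace ℂ (Fin d)) s := by
    intro y hy
    rw [mem_closedBall_zero_iff, norm_smul]
    simp only [Complex.norm_real, Real.norm_eq_abs, abs_of_nonneg hs0]
    nlinarith
  have hconv := convex_closedBall (0 : EuclideanSpace ℂ (Fin d)) s
  have := hconv.norm_image_sub_le_of_norm_hasFDerivWithin_le
    (𝕜 := ℂ) (fun x _ => (hasFDerivAt_polyEval P x).hasFDerivWithinAt) hbound (hmem hw) (hmem hz)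
  refine this.trans ?_
  rw [← smul_sub, norm_smul]
  simp only [Complex.norm_real, Real.norm_eq_abs, abs_of_nonneg hs0]
  have : 0 ≤ M / (1 - s) := by positivity
  have h2 : s * ‖z - w‖ ≤ ‖z - w‖ := by nlinarith [norm_nonneg (z - w)]
  gcongr

def polyMap {d : ℕ} (P : MvPolynomial (Fin d) ℂ) : C(CB d, ℂ) :=
  ⟨fun z => polyEval P z, (continuous_polyEval P).comp continuous_subtype_val⟩

lemma mem_polyAlg_iff {d : ℕ} {f : C(CB d, ℂ)} : f ∈ polyAlg d ↔ ∃ P, polyMap P = f := by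
  let X : Fin d → C(CB d, ℂ) := fun i =>
    ⟨fun z => (z : EuclideanSpace ℂ (Fin d)) i,
      (EuclideanSpace.proj (𝕜 := ℂ) i).continuous.comp continuous_subtype_val⟩
  have hset : { f : C(CB d, ℂ) | ∃ i : Fin d,
        f = ⟨fun z => (z : EuclideanSpace ℂ (Fin d)) i,
             (EuclideanSpace.proj (𝕜 := ℂ) i).continuous.comp continuous_subtype_val⟩ }
      = range X := by
    ext f
    exact exists_congr fun i => eq_comm
  have heval : ∀ P : MvPolynomial (Fin d) ℂ, MvPolynomial.aeval X P = polyMap P := by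
    intro P
    ext z
    induction P using MvPolynomial.induction_on with
    | C a => simp [polyMap, polyEval]
    | add P Q hP hQ =>
      rw [map_add, ContinuousMap.add_apply, hP, hQ]
      simp [polyMap, polyEval]
    | mul_X P n hP =>
      rw [map_mul, ContinuousMap.mul_apply, hP, MvPolynomial.aeval_X]
      simp [polyMap, polyEval]
      exact Or.inl rfl
  rw [polyAlg, hset, Algebra.adjoin_range_eq_range_aeval, AlgHom.mem_range]
  simp only [heval]

lemma polyMap_mem_ballAlgSub {d : ℕ} (P : MvPolynomial (Fin d) ℂ) :
    polyMap P ∈ ballAlgSub d :=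
  Subalgebra.le_topologicalClosure _ (mem_polyAlg_iff.2 ⟨P, rfl⟩)

lemma isClosed_ballAlgSub (d : ℕ) : IsClosed (ballAlgSub d : Set C(CB d, ℂ)) :=
  Subalgebra.isClosed_topologicalClosure _

lemma exists_polyMap_norm_sub_lt {d : ℕ} {f : C(CB d, ℂ)} (hf : f ∈ ballAlgSub d) {ε : ℝ}
    (hε : 0 < ε) : ∃ P : MvPolynomial (Fin d) ℂ, ‖f - polyMap P‖ < ε := by
  have hf' : f ∈ closure (polyAlg d : Set C(CB d, ℂ)) := hf
  obtain ⟨g, hg, hfg⟩ := Metric.mem_closure_iff.1 hf' ε hε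
  obtain ⟨P, rfl⟩ := mem_polyAlg_iff.1 hg
  exact ⟨P, by rwa [← dist_eq_norm]⟩

instance (d : ℕ) : CompactSpace (sphereD d) :=
  isCompact_iff_compactSpace.mp
    (isClosed_eq (by fun_prop) continuous_const : IsClosed (sphereD d)).isCompact

def sphereRestrict (d : ℕ) : C(CB d, ℂ) →ₐ[ℂ] C(sphereD d, ℂ) :=
  ContinuousMap.compRightAlgHom ℂ ℂ ⟨Subtype.val, continuous_subtype_val⟩

@[simp] lemma sphereRestrict_apply {d : ℕ} (f : C(CB d, ℂ)) (z : sphereD d) :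
    sphereRestrict d f z = f z := rfl

lemma norm_sphereRestrict_le {d : ℕ} (f : C(CB d, ℂ)) : ‖sphereRestrict d f‖ ≤ ‖f‖ :=
  (ContinuousMap.norm_le _ (norm_nonneg _)).2 fun z => f.norm_coe_le_norm z

lemma continuous_sphereRestrict (d : ℕ) : Continuous (sphereRestrict d) :=
  ContinuousMap.continuous_precomp _

/-- The maximum modulus principle for the ball algebra. -/
lemma norm_le_norm_sphereRestrict {d : ℕ} (hd : 1 ≤ d) {f : C(CB d, ℂ)}
    (hf : f ∈ ballAlgSub d) : ‖f‖ ≤ ‖sphereRestrict d f‖ := by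
  have hcl : IsClosed {f : C(CB d, ℂ) | ‖f‖ ≤ ‖sphereRestrict d f‖} :=
    isClosed_le continuous_norm (continuous_norm.comp (continuous_sphereRestrict d))
  refine closure_minimal (s := (polyAlg d : Set C(CB d, ℂ))) ?_ hcl hf
  rintro f hf
  obtain ⟨P, rfl⟩ := mem_polyAlg_iff.1 hf
  refine (ContinuousMap.norm_le _ (norm_nonneg _)).2 fun z => ?_
  have : Nonempty (Fin d) := ⟨⟨0, hd⟩⟩
  have hdiff : Differentiable ℂ (polyEval P) := fun x =>
    (hasFDerivAt_polyEval P x).differentiableAt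
  refine Complex.norm_le_of_forall_mem_frontier_norm_le
    (U := ball (0 : EuclideanSpace ℂ (Fin d)) 1) isBounded_ball hdiff.diffContOnCl
    (fun w hw => ?_) (by rw [closure_ball _ one_ne_zero]; exact z.2)
  rw [frontier_ball _ one_ne_zero, mem_sphere_zero_iff_norm] at hw
  exact (sphereRestrict d (polyMap P)).norm_coe_le_norm
    ⟨⟨w, mem_closedBall_zero_iff.2 hw.le⟩, hw⟩

lemma exists_finite_net_dilation {d : ℕ} {M s ε : ℝ} (hs0 : 0 ≤ s) (hs1 : s < 1) (hε : 0 < ε) :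
    ∃ F : Set C(CB d, ℂ), F.Finite ∧ ∀ P : MvPolynomial (Fin d) ℂ,
      (∀ x : EuclideanSpace ℂ (Fin d), ‖x‖ ≤ 1 → ‖polyEval P x‖ ≤ M) →
      ∃ c ∈ F, ∀ z : CB d, ‖polyEval P ((s : ℂ) • (z : EuclideanSpace ℂ (Fin d))) - c z‖ ≤ ε := by
  let D : MvPolynomial (Fin d) ℂ → BoundedContinuousFunction (CB d) ℂ := fun P =>
    BoundedContinuousFunction.mkOfCompact
      ⟨fun z => polyEval P ((s : ℂ) • (z : EuclideanSpace ℂ (Fin d))),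
        (continuous_polyEval P).comp (by fun_prop)⟩
  let A : Set (BoundedContinuousFunction (CB d) ℂ) :=
    D '' {P | ∀ x : EuclideanSpace ℂ (Fin d), ‖x‖ ≤ 1 → ‖polyEval P x‖ ≤ M}
  have hcomp : IsCompact (closure A) := by
    refine BoundedContinuousFunction.arzela_ascoli (closedBall 0 M) (isCompact_closedBall _ _) A
      ?_ ?_
    · rintro _ z ⟨P, hP, rfl⟩
      refine mem_closedBall_zero_iff.2 (hP _ ?_)
      have hz : ‖(z : EuclideanSpace ℂ (Fin d))‖ ≤ 1 := mem_closedBall_zero_iff.1 z.2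
      rw [norm_smul]
      simp only [Complex.norm_real, Real.norm_eq_abs, abs_of_nonneg hs0]
      nlinarith [norm_nonneg (z : EuclideanSpace ℂ (Fin d))]
    · refine Metric.equicontinuous_of_continuity_modulus (fun t => M / (1 - s) * t) ?_ _ ?_
      · exact Continuous.tendsto' (by fun_prop) 0 0 (by simp)
      · rintro z w ⟨_, P, hP, rfl⟩
        rw [dist_eq_norm, Subtype.dist_eq, dist_eq_norm]
        exact norm_polyEval_smul_sub_le hs0 hs1 hP (mem_closedBall_zero_iff.1 z.2)
          (mem_closedBall_zero_iff.1 w.2)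
  obtain ⟨t, ht, htA⟩ := Metric.totallyBounded_iff.1
    (hcomp.totallyBounded.subset subset_closure) ε hε
  refine ⟨(fun c => c.toContinuousMap) '' t, ht.image _, fun P hP => ?_⟩
  obtain ⟨c, hc, hPc⟩ := mem_iUnion₂.1 (htA (mem_image_of_mem D hP))
  refine ⟨_, mem_image_of_mem _ hc, fun z => ?_⟩
  have := (BoundedContinuousFunction.dist_coe_le_dist (f := D P) (g := c) z).trans
    (mem_ball.1 hPc).le
  rwa [dist_eq_norm] at this

/-- Modulo the restrictions of functions in `V`, multiplication by `ψ` maps the unit ball of the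
ball algebra to a totally bounded subset of `C(𝕊_d)`. -/
def IsTightSymbol (d : ℕ) (V : Set C(CB d, ℂ)) (ψ : C(sphereD d, ℂ)) : Prop :=
  ∀ ε > 0, ∃ F : Set C(sphereD d, ℂ), F.Finite ∧ ∀ f ∈ ballAlgSub d, ‖f‖ ≤ 1 →
    ∃ h ∈ V, ∃ c ∈ F, ‖ψ * sphereRestrict d f - sphereRestrict d h - c‖ ≤ ε

namespace IsTightSymbol

variable {d : ℕ} {V : Set C(CB d, ℂ)} {ψ ψ' : C(sphereD d, ℂ)}

lemma add (hV : ∀ f ∈ V, ∀ g ∈ V, f + g ∈ V) (h : IsTightSymbol d V ψ)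
    (h' : IsTightSymbol d V ψ') : IsTightSymbol d V (ψ + ψ') := by
  intro ε hε
  obtain ⟨F, hF, H⟩ := h (ε / 2) (half_pos hε)
  obtain ⟨F', hF', H'⟩ := h' (ε / 2) (half_pos hε)
  refine ⟨_, hF.image2 (· + ·) hF', fun f hf hf1 => ?_⟩
  obtain ⟨g, hg, c, hc, hgc⟩ := H f hf hf1
  obtain ⟨g', hg', c', hc', hgc'⟩ := H' f hf hf1
  refine ⟨g + g', hV g hg g' hg', c + c', mem_image2_of_mem hc hc', ?_⟩
  calc _ = ‖(ψ * sphereRestrict d f - sphereRestrict d g - c) +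
        (ψ' * sphereRestrict d f - sphereRestrict d g' - c')‖ := by
        rw [map_add]; congr 1; ring
    _ ≤ ε / 2 + ε / 2 := (norm_add_le _ _).trans (add_le_add hgc hgc')
    _ = ε := add_halves ε

lemma isClosed_setOf : IsClosed {ψ | IsTightSymbol d V ψ} := by
  refine isClosed_of_closure_subset fun ψ hψ ε hε => ?_
  obtain ⟨ψ', hψ', hd⟩ := Metric.mem_closure_iff.1 hψ (ε / 2) (half_pos hε)
  obtain ⟨F, hF, H⟩ := hψ' (ε / 2) (half_pos hε)
  refine ⟨F, hF, fun f hf hf1 => ?_⟩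
  obtain ⟨g, hg, c, hc, hgc⟩ := H f hf hf1
  refine ⟨g, hg, c, hc, ?_⟩
  rw [dist_eq_norm] at hd
  calc _ = ‖(ψ - ψ') * sphereRestrict d f +
        (ψ' * sphereRestrict d f - sphereRestrict d g - c)‖ := by
        congr 1; ring
    _ ≤ ‖ψ - ψ'‖ * ‖sphereRestrict d f‖ + ε / 2 :=
        (norm_add_le _ _).trans (add_le_add (norm_mul_le _ _) hgc)
    _ ≤ ε / 2 * 1 + ε / 2 := by
        gcongr
        exact (norm_sphereRestrict_le f).trans hf1
    _ = ε := by ring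

lemma mul_sphereRestrict {W : Set C(CB d, ℂ)} (hψ : IsTightSymbol d V ψ) {j : C(CB d, ℂ)}
    (hj : ∀ g ∈ V, g * j ∈ W) : IsTightSymbol d W (ψ * sphereRestrict d j) := by
  intro ε hε
  obtain ⟨F, hF, H⟩ := hψ (ε / (‖sphereRestrict d j‖ + 1)) (by positivity)
  refine ⟨_, hF.image (· * sphereRestrict d j), fun f hf hf1 => ?_⟩
  obtain ⟨g, hg, c, hc, hgc⟩ := H f hf hf1
  refine ⟨g * j, hj g hg, _, mem_image_of_mem _ hc, ?_⟩
  calc _ = ‖(ψ * sphereRestrict d f - sphereRestrict d g - c) * sphereRestrict d j‖ := by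
        rw [map_mul]; congr 1; ring
    _ ≤ ε / (‖sphereRestrict d j‖ + 1) * (‖sphereRestrict d j‖ + 1) := by
        refine (norm_mul_le _ _).trans (mul_le_mul hgc (by linarith) (norm_nonneg _) ?_)
        positivity
    _ = ε := div_mul_cancel₀ _ (by positivity)

lemma of_mem_ballAlg {j : C(CB d, ℂ)} (hj : j ∈ ballAlgSub d) :
    IsTightSymbol d (ballAlg d) (sphereRestrict d j) := by
  intro ε hε
  refine ⟨{0}, finite_singleton 0, fun f hf _ => ⟨j * f, mul_mem hj hf, 0, rfl, ?_⟩⟩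
  simpa using hε.le

lemma mul (hd : 1 ≤ d) (h : IsTightSymbol d (ballAlg d) ψ)
    (h' : IsTightSymbol d (ballAlg d) ψ') : IsTightSymbol d (ballAlg d) (ψ * ψ') := by
  intro ε hε
  obtain ⟨F', hF', H'⟩ := h' (ε / (2 * (‖ψ‖ + 1))) (by positivity)
  obtain ⟨C, hC⟩ : ∃ C, ∀ c ∈ F', ‖c‖ ≤ C := hF'.isBounded.exists_norm_le
  set R : ℝ := ‖ψ'‖ + ε / (2 * (‖ψ‖ + 1)) + |C| + 1 with hR
  have hR0 : 0 < R := by positivity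
  obtain ⟨F, hF, H⟩ := h (ε / (2 * R)) (by positivity)
  refine ⟨_, hF.image2 (fun c c' => (R : ℂ) • c + ψ * c') hF', fun f hf hf1 => ?_⟩
  obtain ⟨g', hg', c', hc', hgc'⟩ := H' f hf hf1
  have hg'R : ‖g'‖ ≤ R := by
    refine (norm_le_norm_sphereRestrict hd hg').trans ?_
    calc _ = ‖ψ' * sphereRestrict d f - (ψ' * sphereRestrict d f - sphereRestrict d g' - c')
          - c'‖ := by congr 1; ring
      _ ≤ ‖ψ'‖ * 1 + ε / (2 * (‖ψ‖ + 1)) + |C| := by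
          refine (norm_sub_le _ _).trans (add_le_add ((norm_sub_le _ _).trans (add_le_add
            ((norm_mul_le _ _).trans ?_) hgc')) ((hC c' hc').trans (le_abs_self C)))
          gcongr
          exact (norm_sphereRestrict_le f).trans hf1
      _ ≤ R := by rw [hR]; linarith
  obtain ⟨g, hg, c, hc, hgc⟩ := H ((R : ℂ)⁻¹ • g') (Subalgebra.smul_mem _ hg' _) (by
    rw [norm_smul, norm_inv, Complex.norm_real, Real.norm_of_nonneg hR0.le]
    exact inv_mul_le_one_of_le₀ hg'R hR0.le)
  refine ⟨(R : ℂ) • g, Subalgebra.smul_mem _ hg _, _, mem_image2_of_mem hc hc', ?_⟩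
  have hRc : (R : ℂ) ≠ 0 := by exact_mod_cast hR0.ne'
  calc _ = ‖(R : ℂ) • (ψ * sphereRestrict d ((R : ℂ)⁻¹ • g') - sphereRestrict d g - c) +
        ψ * (ψ' * sphereRestrict d f - sphereRestrict d g' - c')‖ := by
        congr 1
        rw [map_smul, map_smul, smul_sub, smul_sub, mul_smul_comm, smul_inv_smul₀ hRc]
        ring
    _ ≤ R * (ε / (2 * R)) + (‖ψ‖ + 1) * (ε / (2 * (‖ψ‖ + 1))) := by
        refine (norm_add_le _ _).trans (add_le_add ?_ ((norm_mul_le _ _).trans ?_))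
        · rw [norm_smul, Complex.norm_real, Real.norm_of_nonneg hR0.le]
          gcongr
        · gcongr
          linarith
    _ = ε := by field_simp; norm_num

end IsTightSymbol

def sphereCoord {d : ℕ} (i : Fin d) : C(sphereD d, ℂ) :=
  sphereRestrict d (polyMap (MvPolynomial.X i))

lemma sphereCoord_apply {d : ℕ} (i : Fin d) (z : sphereD d) :
    sphereCoord i z = (z : EuclideanSpace ℂ (Fin d)) i := by
  simp [sphereCoord, polyMap, polyEval]

lemma isTightSymbol_star_sphereCoord {d : ℕ} (i : Fin d) :
    IsTightSymbol d (ballAlg d) (star (sphereCoord i)) := by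
  intro ε hε
  set δ : ℝ := min 1 (ε / 12) with hδ
  have hδ0 : 0 < δ := by positivity
  have hδ1 : δ ≤ 1 := min_le_left _ _
  have hδε : δ ≤ ε / 12 := min_le_right _ _
  have hs0 : 0 ≤ 1 - δ ^ 2 := by nlinarith
  have hs1 : 1 - δ ^ 2 < 1 := by nlinarith
  obtain ⟨F, hF, H⟩ := exists_finite_net_dilation (d := d) (M := 2) hs0 hs1
    (show 0 < ε / 3 by positivity)
  refine ⟨_, hF.image (fun c => star (sphereCoord i) * sphereRestrict d c), fun f hf hf1 => ?_⟩
  obtain ⟨P, hP⟩ := exists_polyMap_norm_sub_lt hf hδ0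
  have hP2 : ∀ x : EuclideanSpace ℂ (Fin d), ‖x‖ ≤ 1 → ‖polyEval P x‖ ≤ 2 := by
    intro x hx
    have h1 : ‖polyEval P x‖ ≤ ‖polyMap P‖ :=
      (polyMap P).norm_coe_le_norm ⟨x, mem_closedBall_zero_iff.2 hx⟩
    have h2 := norm_sub_norm_le (polyMap P) f
    rw [norm_sub_rev] at h2
    linarith
  obtain ⟨c, hc, hPc⟩ := H P hP2
  obtain ⟨G, hG⟩ := exists_poly_conj_mul_sub i hs0 hs1 hP2
  refine ⟨polyMap G, polyMap_mem_ballAlgSub G, _, mem_image_of_mem _ hc, ?_⟩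
  refine (ContinuousMap.norm_le _ hε.le).2 fun z => ?_
  have hz : ‖((z : CB d) : EuclideanSpace ℂ (Fin d))‖ = 1 := z.2
  have h1 := hG _ hz
  have h2 := hPc z
  have h3 : ‖f z - polyEval P z‖ ≤ δ := ((f - polyMap P).norm_coe_le_norm (z : CB d)).trans hP.le
  have h4 : ‖star (((z : CB d) : EuclideanSpace ℂ (Fin d)) i)‖ ≤ 1 := by
    rw [norm_star]; exact (PiLp.norm_apply_le _ i).trans hz.le
  have hsq : √(1 - (1 - δ ^ 2)) = δ := by
    rw [sub_sub_cancel, Real.sqrt_sq hδ0.le]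
  rw [hsq] at h1
  set a := star (((z : CB d) : EuclideanSpace ℂ (Fin d)) i)
  set p := polyEval P (((1 - δ ^ 2 : ℝ) : ℂ) • ((z : CB d) : EuclideanSpace ℂ (Fin d)))
  have heq : (star (sphereCoord i) * sphereRestrict d f - sphereRestrict d (polyMap G) -
      star (sphereCoord i) * sphereRestrict d c) z =
      a * (f z - polyEval P z) + (a * (polyEval P z - p) - polyEval G z) + a * (p - c z) := by
    simp only [ContinuousMap.sub_apply, ContinuousMap.mul_apply, ContinuousMap.star_apply,
      sphereRestrict_apply, sphereCoord_apply, a]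
    simp only [polyMap, ContinuousMap.coe_mk]
    ring
  rw [heq]
  calc _ ≤ 1 * δ + 2 * 2 * δ + 1 * (ε / 3) := by
        refine (norm_add₃_le).trans ?_
        rw [norm_mul, norm_mul a (p - c z)]
        gcongr
    _ ≤ ε := by linarith

/-- Every continuous function on the sphere is a tight symbol for the ball algebra: the ball algebra
is a strongly tight uniform algebra. -/
lemma isTightSymbol_ballAlg {d : ℕ} (hd : 1 ≤ d) (ψ : C(sphereD d, ℂ)) :
    IsTightSymbol d (ballAlg d) ψ := by
  let S : StarSubalgebra ℂ C(sphereD d, ℂ) := StarAlgebra.adjoin ℂ (range sphereCoord)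
  have hsep : S.SeparatesPoints := by
    intro z w hzw
    by_contra! hne
    refine hzw (Subtype.ext (Subtype.ext (PiLp.ext fun i => ?_)))
    have := hne _ ⟨sphereCoord i, StarAlgebra.subset_adjoin ℂ _ (mem_range_self i), rfl⟩
    change sphereCoord i z = sphereCoord i w at this
    rwa [sphereCoord_apply, sphereCoord_apply] at this
  have htop := ContinuousMap.starSubalgebra_topologicalClosure_eq_top_of_separatesPoints S hsep
  have hψ : ψ ∈ closure (S : Set C(sphereD d, ℂ)) := by
    rw [← StarSubalgebra.topologicalClosure_coe, htop]
    trivial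
  refine closure_minimal (fun f hf => ?_) IsTightSymbol.isClosed_setOf hψ
  have hf' : f ∈ Algebra.adjoin ℂ (range sphereCoord ∪ star (range sphereCoord)) := by
    rw [← StarAlgebra.adjoin_toSubalgebra]; exact hf
  clear hf
  induction hf' using Algebra.adjoin_induction with
  | mem x hx =>
    rcases hx with ⟨i, rfl⟩ | ⟨i, hi⟩
    · exact .of_mem_ballAlg (polyMap_mem_ballAlgSub _)
    · rw [← star_star x, ← hi]
      exact isTightSymbol_star_sphereCoord i
  | algebraMap r =>
    rw [← AlgHom.commutes (sphereRestrict d) r]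
    exact .of_mem_ballAlg (Subalgebra.algebraMap_mem _ r)
  | add x y _ _ hx hy =>
    exact hx.add (fun f hf g hg => add_mem (S := Subalgebra ℂ C(CB d, ℂ)) hf hg) hy
  | mul x y _ _ hx hy => exact hx.mul hd hy

lemma IX_add_mem {d : ℕ} {X : Set (CB d)} {f g : C(CB d, ℂ)} (hf : f ∈ IX d X) (hg : g ∈ IX d X) :
    f + g ∈ IX d X :=
  ⟨(ballAlgSub d).add_mem hf.1 hg.1, fun z hz => by
    rw [ContinuousMap.add_apply, hf.2 z hz, hg.2 z hz, add_zero]⟩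

lemma IX_mul_mem {d : ℕ} {X : Set (CB d)} {f g : C(CB d, ℂ)} (hf : f ∈ ballAlg d)
    (hg : g ∈ IX d X) : f * g ∈ IX d X :=
  ⟨(ballAlgSub d).mul_mem hf hg.1, fun z hz => by
    rw [ContinuousMap.mul_apply, hg.2 z hz, mul_zero]⟩

lemma zero_mem_IX {d : ℕ} (X : Set (CB d)) : (0 : C(CB d, ℂ)) ∈ IX d X :=
  ⟨(ballAlgSub d).zero_mem, fun _ _ => rfl⟩

/-- A continuous function on the sphere vanishing on the common zeros of `IX d X` there multiplies
the unit ball of the ball algebra to a totally bounded set modulo `IX d X`. -/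
lemma isTightSymbol_IX {d : ℕ} (hd : 1 ≤ d) {X : Set (CB d)} {ψ : C(sphereD d, ℂ)}
    (hψ : ∀ z : sphereD d, (∀ f ∈ IX d X, f z = 0) → ψ z = 0) : IsTightSymbol d (IX d X) ψ := by
  let I : Ideal C(sphereD d, ℂ) := Ideal.span (sphereRestrict d '' IX d X)
  have hI : ψ ∈ closure (I : Set C(sphereD d, ℂ)) := by
    have : ψ ∈ ContinuousMap.idealOfSet ℂ (ContinuousMap.setOfIdeal I) := by
      refine ContinuousMap.mem_idealOfSet.2 fun z hz => hψ z fun f hf => ?_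
      exact ContinuousMap.notMem_setOfIdeal.1 hz (Ideal.subset_span (mem_image_of_mem _ hf))
    rw [ContinuousMap.idealOfSet_ofIdeal_eq_closure] at this
    exact this
  refine closure_minimal (fun g (hg : g ∈ Submodule.span _ _) => ?_)
    IsTightSymbol.isClosed_setOf hI
  induction hg using Submodule.closure_induction with
  | zero =>
    exact fun ε hε => ⟨{0}, finite_singleton 0, fun f _ _ =>
      ⟨0, zero_mem_IX X, 0, rfl, by simpa using hε.le⟩⟩
  | add x y _ _ hx hy => exact hx.add (fun f hf g hg => IX_add_mem hf hg) hy
  | smul_mem r x hx =>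
    obtain ⟨j, hj, rfl⟩ := hx
    exact (isTightSymbol_ballAlg hd r).mul_sphereRestrict fun g hg => IX_mul_mem hg hj

lemma exists_finite_net_of_norm_le {d : ℕ} (hd : 1 ≤ d) {X : Set (CB d)} {Φ : C(CB d, ℂ)} {r : ℝ}
    (hr : 0 < r) (hΦ : ∀ z : sphereD d, (∀ f ∈ IX d X, f z = 0) → ‖Φ z‖ ≤ r) :
    ∃ F : Set C(sphereD d, ℂ), F.Finite ∧ ∀ f ∈ ballAlgSub d, ‖f‖ ≤ 1 →
      ∃ h ∈ IX d X, ∃ c ∈ F,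
        ‖sphereRestrict d (Φ * f) - sphereRestrict d h - c‖ ≤ 2 * r := by
  have hpos : ∀ z : sphereD d, (0 : ℝ) < max r ‖Φ z‖ := fun z => lt_max_of_lt_left hr
  let Φ₁ : C(sphereD d, ℂ) := ⟨fun z => ((r / max r ‖Φ z‖ : ℝ) : ℂ) * Φ z, by
    have : ∀ z : sphereD d, max r ‖Φ z‖ ≠ 0 := fun z => (hpos z).ne'
    fun_prop (disch := assumption)⟩
  have hΦ₁ : ‖Φ₁‖ ≤ r := by
    refine (ContinuousMap.norm_le _ hr.le).2 fun z => ?_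
    change ‖((r / max r ‖Φ z‖ : ℝ) : ℂ) * Φ z‖ ≤ r
    rw [norm_mul, Complex.norm_real, Real.norm_of_nonneg (div_pos hr (hpos z)).le,
      div_mul_eq_mul_div, div_le_iff₀ (hpos z)]
    exact mul_le_mul_of_nonneg_left (le_max_right _ _) hr.le
  obtain ⟨F, hF, H⟩ := isTightSymbol_IX hd (X := X) (ψ := sphereRestrict d Φ - Φ₁)
    (fun z hz => by
      have h := hΦ z hz
      change Φ z - ((r / max r ‖Φ z‖ : ℝ) : ℂ) * Φ z = 0
      rw [max_eq_left h, div_self hr.ne', Complex.ofReal_one, one_mul, sub_self]) r hr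
  refine ⟨F, hF, fun f hf hf1 => ?_⟩
  obtain ⟨h, hh, c, hc, hle⟩ := H f hf hf1
  refine ⟨h, hh, c, hc, ?_⟩
  calc _ = ‖((sphereRestrict d Φ - Φ₁) * sphereRestrict d f - sphereRestrict d h - c)
        + Φ₁ * sphereRestrict d f‖ := by
        rw [map_mul]; congr 1; ring
    _ ≤ r + r * 1 := by
        refine (norm_add_le _ _).trans (add_le_add hle ((norm_mul_le _ _).trans ?_))
        exact mul_le_mul hΦ₁ ((norm_sphereRestrict_le f).trans hf1) (norm_nonneg _) hr.le
    _ = 2 * r := by ring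

/-- In a commutative Banach algebra, an element whose powers are, up to `C r ^ n`, of finite rank on
the unit ball has eigenvalues of modulus larger than `r` as soon as its spectral radius exceeds
`r`. -/
lemma exists_eigenvector_of_mem_spectrum {Q : Type*} [NormedCommRing Q] [NormedAlgebra ℂ Q]
    [CompleteSpace Q] [Nontrivial Q] {x : Q} {z : ℂ} (hz : z ∈ spectrum ℂ x) {r C : ℝ}
    (hr : 0 < r) (hrz : r < ‖z‖)
    (H : ∀ n : ℕ, ∃ (β : Type*) (_ : Finite β) (G : Q → β), ∀ q q', ‖q‖ ≤ 1 → ‖q'‖ ≤ 1 →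
      G q = G q' → ‖x ^ n * (q - q')‖ ≤ C * r ^ n) :
    ∃ w : ℂ, r < ‖w‖ ∧ ∃ q : Q, q ≠ 0 ∧ (algebraMap ℂ Q w - x) * q = 0 := by
  obtain ⟨w, hw, hwr⟩ := spectrum.exists_nnnorm_eq_spectralRadius_of_nonempty (𝕜 := ℂ) ⟨z, hz⟩
  have hzw : ‖z‖ ≤ ‖w‖ := by
    have h : (‖z‖₊ : ENNReal) ≤ ‖w‖₊ := by
      rw [hwr]; exact le_iSup₂ (f := fun k (_ : k ∈ spectrum ℂ x) => (‖k‖₊ : ENNReal)) z hz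
    exact_mod_cast h
  have hrw : r < ‖w‖ := hrz.trans_le hzw
  have hw0 : 0 < ‖w‖ := hr.trans hrw
  refine ⟨w, hrw, ?_⟩
  have hε : Tendsto (fun k : ℕ => (1 : ℝ) / (k + 1)) atTop (𝓝 0) :=
    tendsto_one_div_add_atTop_nhds_zero_nat
  have hinv : ∀ k : ℕ, ∃ y : Q,
      (algebraMap ℂ Q ((1 + ((1 / (k + 1) : ℝ) : ℂ)) * w) - x) * y = 1 := by
    intro k
    have hk : (0 : ℝ) < 1 / (k + 1) := by positivity
    have hmem : (1 + ((1 / (k + 1) : ℝ) : ℂ)) * w ∈ resolventSet ℂ x := by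
      refine spectrum.mem_resolventSet_of_spectralRadius_lt ?_
      rw [← hwr]
      norm_cast
      rw [← NNReal.coe_lt_coe, coe_nnnorm, coe_nnnorm, norm_mul]
      have : ‖((1 : ℝ) + (1 / (k + 1) : ℝ) : ℂ)‖ = 1 + 1 / (k + 1) := by
        rw [← Complex.ofReal_add, Complex.norm_real, Real.norm_of_nonneg (by positivity)]
      push_cast at this ⊢
      rw [this]
      nlinarith
    exact IsUnit.exists_right_inv (spectrum.mem_resolventSet_iff.1 hmem)
  choose y hy using hinv
  have hy1 : ∀ k : ℕ, 1 ≤ 1 / ((k : ℝ) + 1) * ‖w‖ * ‖y k‖ := by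
    intro k
    by_contra! hlt
    have hlt' : ‖algebraMap ℂ Q (((1 / (k + 1) : ℝ) : ℂ) * w) * y k‖ < 1 := by
      rw [← Algebra.smul_def, norm_smul, norm_mul, Complex.norm_real,
        Real.norm_of_nonneg (by positivity)]
      exact hlt
    have hu := isUnit_one_sub_of_norm_lt_one hlt'
    have heq : (1 : Q) - algebraMap ℂ Q (((1 / (k + 1) : ℝ) : ℂ) * w) * y k =
        (algebraMap ℂ Q w - x) * y k := by
      rw [← hy k, add_mul, one_mul, map_add]; ring
    rw [heq] at hu
    exact hw (isUnit_of_mul_isUnit_left hu)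
  have hy0 : ∀ k, 0 < ‖y k‖ := fun k => by
    refine (norm_nonneg _).lt_of_ne fun h0 => ?_
    have := hy1 k
    rw [← h0, mul_zero] at this
    linarith
  let q : ℕ → Q := fun k => ((‖y k‖⁻¹ : ℝ) : ℂ) • y k
  have hq1 : ∀ k, ‖q k‖ = 1 := fun k => by
    rw [norm_smul, Complex.norm_real, norm_inv, norm_norm, inv_mul_cancel₀ (hy0 k).ne']
  have hlim : Tendsto (fun k => (algebraMap ℂ Q w - x) * q k) atTop (𝓝 0) := by
    have hb : ∀ k : ℕ, ‖(algebraMap ℂ Q w - x) * q k‖ ≤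
        1 / ((k : ℝ) + 1) * (‖w‖ * ‖(1 : Q)‖ + ‖w‖) := by
      intro k
      have heq : (algebraMap ℂ Q w - x) * q k = ((‖y k‖⁻¹ : ℝ) : ℂ) • (1 : Q) -
          (((1 / (k + 1) : ℝ) : ℂ) * w) • q k := by
        rw [← hy k, Algebra.smul_def (_ * w), add_mul, one_mul, map_add, mul_smul_comm,
          mul_smul_comm, ← smul_sub]
        congr 1
        ring
      rw [heq]
      refine (norm_sub_le _ _).trans ?_
      rw [norm_smul, norm_smul, hq1, norm_mul, Complex.norm_real, Complex.norm_real, norm_inv,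
        norm_norm, Real.norm_of_nonneg (show (0 : ℝ) ≤ 1 / (k + 1) by positivity), mul_add,
        mul_one, ← mul_assoc]
      gcongr
      rw [inv_le_iff_one_le_mul₀ (hy0 k)]
      exact hy1 k
    refine squeeze_zero_norm hb ?_
    simpa using hε.mul_const (‖w‖ * ‖(1 : Q)‖ + ‖w‖)
  have htb : TotallyBounded (range q) := by
    refine Metric.totallyBounded_iff.2 fun ε hε0 => ?_
    obtain ⟨n, hn⟩ : ∃ n : ℕ, C * (r / ‖w‖) ^ n < ε / 3 := by
      have h : Tendsto (fun n : ℕ => C * (r / ‖w‖) ^ n) atTop (𝓝 (C * 0)) :=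
        (tendsto_pow_atTop_nhds_zero_of_lt_one (by positivity)
          ((div_lt_one hw0).2 hrw)).const_mul C
      rw [mul_zero] at h
      exact (h.eventually_lt_const (by positivity)).exists
    have hwn : 0 < ‖w‖ ^ n := pow_pos hw0 n
    have hpow : Tendsto (fun k => (algebraMap ℂ Q (w ^ n) - x ^ n) * q k) atTop (𝓝 0) := by
      obtain ⟨u, hu⟩ := sub_dvd_pow_sub_pow (algebraMap ℂ Q w) x n
      have h := hlim.const_mul u
      rw [mul_zero] at h
      refine h.congr fun k => ?_
      rw [map_pow, hu]; ring
    obtain ⟨K, hK⟩ := eventually_atTop.1 (hpow.norm.eventually_lt_const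
      (show ‖(0 : Q)‖ < ‖w‖ ^ n * (ε / 3) by rw [norm_zero]; positivity))
    obtain ⟨β, _, G, hG⟩ := H n
    have hdist : ∀ k ≥ K, ∀ l ≥ K, G (q k) = G (q l) → dist (q k) (q l) < ε := by
      intro k hk l hl hkl
      have h1 := hK k hk
      have h2 := hK l hl
      have h3 := hG (q k) (q l) (hq1 k).le (hq1 l).le hkl
      have h4 : ‖w‖ ^ n * ‖q k - q l‖ < ‖w‖ ^ n * ε := by
        calc ‖w‖ ^ n * ‖q k - q l‖ = ‖algebraMap ℂ Q (w ^ n) * (q k - q l)‖ := by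
              rw [← Algebra.smul_def, norm_smul, norm_pow]
          _ = ‖(algebraMap ℂ Q (w ^ n) - x ^ n) * q k + x ^ n * (q k - q l) -
                (algebraMap ℂ Q (w ^ n) - x ^ n) * q l‖ := by congr 1; ring
          _ ≤ ‖(algebraMap ℂ Q (w ^ n) - x ^ n) * q k‖ + ‖x ^ n * (q k - q l)‖ +
                ‖(algebraMap ℂ Q (w ^ n) - x ^ n) * q l‖ :=
              (norm_sub_le _ _).trans (add_le_add_left (norm_add_le _ _) _)
          _ < ‖w‖ ^ n * (ε / 3) + ‖w‖ ^ n * (ε / 3) + ‖w‖ ^ n * (ε / 3) := by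
              have h5 : C * r ^ n < ‖w‖ ^ n * (ε / 3) := by
                rw [div_pow, ← mul_div_assoc, div_lt_iff₀ hwn] at hn
                linarith
              linarith
          _ = ‖w‖ ^ n * ε := by ring
      rw [dist_eq_norm]
      exact lt_of_mul_lt_mul_left h4 hwn.le
    have hfin : (G '' (q '' Ici K)).Finite := toFinite _
    obtain ⟨t, htsub, ht⟩ := exists_subset_bijOn (q '' Ici K) G
    refine ⟨q '' Iio K ∪ t, ((finite_Iio K).image q).union (ht.finite_iff_finite.2 hfin), ?_⟩
    rintro _ ⟨k, rfl⟩
    rcases lt_or_ge k K with hk | hk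
    · exact mem_biUnion (Or.inl (mem_image_of_mem q hk)) (mem_ball_self hε0)
    · obtain ⟨p, hp, hpk⟩ := ht.surjOn (mem_image_of_mem G (mem_image_of_mem q (mem_Ici.2 hk)))
      obtain ⟨l, hl, rfl⟩ := htsub hp
      exact mem_biUnion (Or.inr hp) (hdist k hk l hl hpk.symm)
  obtain ⟨a, -, φ, hφ, ha⟩ := htb.closure.isCompact_of_isClosed isClosed_closure
    |>.tendsto_subseq (x := q) fun k => subset_closure (mem_range_self k)
  refine ⟨a, ?_, ?_⟩
  · have h := tendsto_nhds_unique ha.norm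
      ((tendsto_const_nhds (x := (1 : ℝ))).congr fun k => (hq1 (φ k)).symm)
    rintro rfl
    simp at h
  · exact tendsto_nhds_unique (ha.const_mul _) (hlim.comp hφ.tendsto_atTop)

lemma exists_eigenvector_mod_ideal {A : Type*} [NormedCommRing A] [NormedAlgebra ℂ A]
    [CompleteSpace A] {J : Ideal A} (hJ : IsClosed (J : Set A)) (χ : A →ₐ[ℂ] ℂ)
    (hχ : ∀ a ∈ J, χ a = 0) {x : A} {r C : ℝ} (hr : 0 < r) (hrx : r < ‖χ x‖)
    (H : ∀ n : ℕ, ∃ (β : Type*) (_ : Finite β) (R : A → β → Prop),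
      (∀ f, ‖f‖ ≤ 2 → ∃ b, R f b) ∧
      ∀ f f' b, R f b → R f' b → ∃ h ∈ J, ‖x ^ n * (f - f') - h‖ ≤ C * r ^ n) :
    ∃ w : ℂ, r < ‖w‖ ∧ ∃ f : A, f ∉ J ∧ (algebraMap ℂ A w - x) * f ∈ J := by
  let χ' : A ⧸ J →ₐ[ℂ] ℂ := Ideal.Quotient.liftₐ J χ hχ
  have : Nontrivial (A ⧸ J) := by
    refine Ideal.Quotient.nontrivial_iff.2 fun htop => ?_
    have := hχ 1 (htop ▸ Submodule.mem_top)
    rw [map_one] at this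
    exact one_ne_zero this
  have hz : χ x ∈ spectrum ℂ (Ideal.Quotient.mk J x) := AlgHom.apply_mem_spectrum χ' _
  obtain ⟨w, hw, q, hq0, hq⟩ := exists_eigenvector_of_mem_spectrum (C := C) hz hr hrx fun n => by
    obtain ⟨β, hβ, R, hR, hR'⟩ := H n
    have hlift : ∀ q : A ⧸ J, ∃ f : A, ∃ b : Option β, Ideal.Quotient.mk J f = q ∧
        (‖q‖ ≤ 1 → ∃ b', b = some b' ∧ R f b') := by
      intro q
      obtain ⟨f, hf, hfq⟩ := Ideal.Quotient.norm_mk_lt q one_pos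
      by_cases h1 : ‖q‖ ≤ 1
      · obtain ⟨b, hb⟩ := hR f (by linarith)
        exact ⟨f, some b, hf, fun _ => ⟨b, rfl, hb⟩⟩
      · exact ⟨f, none, hf, fun h => absurd h h1⟩
    choose L G hL hG using hlift
    refine ⟨Option β, inferInstance, G, fun q q' hq hq' hqq' => ?_⟩
    obtain ⟨b, hb, hRb⟩ := hG q hq
    obtain ⟨b', hb', hRb'⟩ := hG q' hq'
    obtain rfl : b = b' := Option.some.inj (hb.symm.trans (hqq'.trans hb'))
    obtain ⟨h, hh, hle⟩ := hR' _ _ b hRb hRb'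
    refine le_trans ?_ hle
    have heq : Ideal.Quotient.mk J (x ^ n * (L q - L q') - h) =
        Ideal.Quotient.mk J x ^ n * (q - q') := by
      rw [map_sub, map_mul, map_pow, map_sub, hL, hL, Ideal.Quotient.eq_zero_iff_mem.2 hh,
        sub_zero]
    rw [← heq]
    exact Ideal.Quotient.norm_mk_le J _
  obtain ⟨f, rfl⟩ := Ideal.Quotient.mk_surjective q
  refine ⟨w, hw, f, fun h => hq0 (Ideal.Quotient.eq_zero_iff_mem.2 h), ?_⟩
  rw [← Ideal.Quotient.eq_zero_iff_mem, map_mul, map_sub]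
  exact hq

lemma exists_net_pow_mul_sub {d : ℕ} (hd : 1 ≤ d) {X : Set (CB d)} {φ : C(CB d, ℂ)}
    (hφ : φ ∈ ballAlgSub d) {s : ℝ} (hs : 0 < s)
    (hφs : ∀ z : sphereD d, (∀ f ∈ IX d X, f z = 0) → ‖φ z‖ ≤ s) (n : ℕ) :
    ∃ (β : Type) (_ : Finite β) (R : C(CB d, ℂ) → β → Prop),
      (∀ f ∈ ballAlgSub d, ‖f‖ ≤ 2 → ∃ b, R f b) ∧
      ∀ f ∈ ballAlgSub d, ∀ f' ∈ ballAlgSub d, ∀ b, R f b → R f' b →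
        ∃ h ∈ IX d X, ‖φ ^ n * (f - f') - h‖ ≤ 8 * s ^ n := by
  obtain ⟨F, hF, H⟩ := exists_finite_net_of_norm_le hd (X := X) (Φ := φ ^ n)
    (pow_pos hs n) fun z hz => by
      rw [ContinuousMap.pow_apply, norm_pow]
      exact pow_le_pow_left₀ (norm_nonneg _) (hφs z hz) n
  refine ⟨F, hF.to_subtype, fun f c => ∃ h ∈ IX d X,
    ‖sphereRestrict d (φ ^ n * ((2 : ℂ)⁻¹ • f)) - sphereRestrict d h - c‖
      ≤ 2 * s ^ n, fun f hf hf2 => ?_, ?_⟩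
  · obtain ⟨h, hh, c, hc, hle⟩ := H _ (Subalgebra.smul_mem _ hf (2 : ℂ)⁻¹) (by
      rw [norm_smul, norm_inv, Complex.norm_ofNat]
      linarith)
    exact ⟨⟨c, hc⟩, h, hh, hle⟩
  · rintro f hf f' hf' c ⟨h, hh, hle⟩ ⟨h', hh', hle'⟩
    have hk : (2 : ℂ) • (h - h') ∈ IX d X := by
      refine ⟨Subalgebra.smul_mem _ (Subalgebra.sub_mem _ hh.1 hh'.1) _, fun z hz => ?_⟩
      simp [hh.2 z hz, hh'.2 z hz]
    refine ⟨_, hk, ?_⟩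
    have hmem : φ ^ n * (f - f') - (2 : ℂ) • (h - h') ∈ ballAlgSub d :=
      Subalgebra.sub_mem _ (Subalgebra.mul_mem _ (Subalgebra.pow_mem _ hφ n)
        (Subalgebra.sub_mem _ hf hf')) hk.1
    refine (norm_le_norm_sphereRestrict hd hmem).trans ?_
    calc _ = ‖(2 : ℂ) • ((sphereRestrict d (φ ^ n * ((2 : ℂ)⁻¹ • f)) -
            sphereRestrict d h - c) - (sphereRestrict d (φ ^ n * ((2 : ℂ)⁻¹ • f')) -
            sphereRestrict d h' - c))‖ := by
          congr 1
          ext z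
          simp
          ring
      _ ≤ 2 * (2 * s ^ n + 2 * s ^ n) := by
          rw [norm_smul, Complex.norm_ofNat]
          gcongr
          exact (norm_sub_le _ _).trans (add_le_add hle hle')
      _ = 8 * s ^ n := by ring

/-- On the common zero set of `IX d X`, functions in the ball algebra are bounded by their suprema
over the part of that zero set lying in the sphere. -/
lemma norm_apply_le_of_mem_ZS_IX {d : ℕ} (hd : 1 ≤ d) {X : Set (CB d)}
    (hX : ∀ z ∈ sphereD d, z ∈ ZS d (IX d X) → z ∈ X) {lam : CB d} (hlam : lam ∈ ZS d (IX d X))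
    {φ : C(CB d, ℂ)} (hφ : φ ∈ ballAlgSub d) {r : ℝ} (hr : 0 ≤ r) (hφr : ∀ x ∈ X, ‖φ x‖ ≤ r) :
    ‖φ lam‖ ≤ r := by
  by_contra! hlt
  obtain ⟨s, hrs, hs⟩ := exists_between hlt
  have hs0 : 0 < s := hr.trans_lt hrs
  have hcomp : CompleteSpace (ballAlgSub d) := (isClosed_ballAlgSub d).completeSpace_coe
  let J : Ideal (ballAlgSub d) :=
    { carrier := {f | (f : C(CB d, ℂ)) ∈ IX d X}
      add_mem' := fun hf hg => IX_add_mem hf hg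
      zero_mem' := zero_mem_IX X
      smul_mem' := fun c f hf => IX_mul_mem c.2 hf }
  have hJmem : ∀ f : ballAlgSub d, f ∈ J ↔ ∀ x ∈ X, (f : C(CB d, ℂ)) x = 0 :=
    fun f => ⟨fun h => h.2, fun h => ⟨f.2, h⟩⟩
  have hJ : IsClosed (J : Set (ballAlgSub d)) := by
    have : (J : Set (ballAlgSub d)) = ⋂ x ∈ X, {f : ballAlgSub d | (f : C(CB d, ℂ)) x = 0} := by
      ext f
      simp only [SetLike.mem_coe, hJmem, mem_iInter, mem_ofPred_eq]
    rw [this]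
    exact isClosed_biInter fun x _ => isClosed_eq
      ((continuous_eval_const x).comp continuous_subtype_val) continuous_const
  let χ : ballAlgSub d →ₐ[ℂ] ℂ := (ContinuousMap.evalAlgHom ℂ ℂ lam).comp (ballAlgSub d).val
  obtain ⟨w, hw, f, hf, hwf⟩ := exists_eigenvector_mod_ideal hJ χ (x := ⟨φ, hφ⟩) (C := 8)
    (fun a ha => hlam a ha) hs0 hs fun n => by
      obtain ⟨β, hβ, R, hR, hR'⟩ := exists_net_pow_mul_sub hd hφ hs0
        (fun z hz => (hφr z (hX z z.2 hz)).trans hrs.le) n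
      refine ⟨β, hβ, fun f b => R f b, fun f hf => hR f f.2 hf, fun f f' b hb hb' => ?_⟩
      obtain ⟨h, hh, hle⟩ := hR' f f.2 f' f'.2 b hb hb'
      exact ⟨⟨h, hh.1⟩, hh, hle⟩
  refine hf ((hJmem f).2 fun x hx => ?_)
  have h0 : (w - φ x) * (f : C(CB d, ℂ)) x = 0 := (hJmem _).1 hwf x hx
  refine (mul_eq_zero.1 h0).resolve_left fun h => ?_
  rw [sub_eq_zero] at h
  have := hφr x hx
  rw [← h] at this
  linarith

/-- A functional which is positive with respect to a unital linear map into `C(K, ℝ)` is represented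
by a measure on `K`. -/
lemma exists_measure_integral_eq {V K : Type*} [AddCommGroup V] [Module ℝ V] [TopologicalSpace K]
    [CompactSpace K] [T2Space K] [MeasurableSpace K] [BorelSpace K] (T : V →ₗ[ℝ] C(K, ℝ))
    (l : V →ₗ[ℝ] ℝ) {v₀ : V} (hv₀ : T v₀ = 1) (hl : ∀ v, (∀ k, 0 ≤ T v k) → 0 ≤ l v) :
    ∃ μ : Measure K, IsFiniteMeasure μ ∧ ∀ v, ∫ k, T v k ∂μ = l v := by
  let s : PointedCone ℝ (V × C(K, ℝ)) :=
    { carrier := {p | ∀ k, 0 ≤ T p.1 k + p.2 k}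
      add_mem' := fun {p q} hp hq k => by
        have h1 := hp k
        have h2 := hq k
        simp only [Prod.fst_add, Prod.snd_add, map_add, ContinuousMap.add_apply]
        linarith
      zero_mem' := fun k => by simp
      smul_mem' := fun c p hp k => by
        change 0 ≤ T ((c : ℝ) • p.1) k + (c : ℝ) * p.2 k
        rw [map_smul, ContinuousMap.smul_apply, smul_eq_mul, ← mul_add]
        exact mul_nonneg c.2 (hp k) }
  let f : V × C(K, ℝ) →ₗ.[ℝ] ℝ :=
    ⟨LinearMap.ker (LinearMap.snd ℝ V C(K, ℝ)),
      (l ∘ₗ LinearMap.fst ℝ V C(K, ℝ)).domRestrict _⟩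
  obtain ⟨g, hgf, hg⟩ := riesz_extension s f
    (by
      rintro ⟨⟨v, u⟩, hu⟩ h
      obtain rfl : u = 0 := hu
      exact hl v fun k => by simpa using h k)
    (by
      rintro ⟨v, u⟩
      refine ⟨⟨((‖T v‖ + ‖u‖) • v₀, 0), rfl⟩, fun k => ?_⟩
      have h1 := (abs_le.1 ((T v).norm_coe_le_norm k)).1
      have h2 := (abs_le.1 (u.norm_coe_le_norm k)).1
      simp only [Prod.mk_add_mk, zero_add, map_add, map_smul, hv₀, ContinuousMap.add_apply,
        ContinuousMap.smul_apply, ContinuousMap.one_apply, smul_eq_mul, mul_one]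
      linarith)
  have hgl : ∀ v, g (0, T v) = l v := by
    intro v
    have h1 : g (v, 0) = l v := hgf ⟨(v, 0), rfl⟩
    have h2 : 0 ≤ g (v, -T v) := hg _ fun k => by simp
    have h3 : 0 ≤ g (-v, T v) := hg _ fun k => by simp
    have h4 : g (v, -T v) = g (v, 0) - g (0, T v) := by rw [← map_sub]; simp
    have h5 : g (-v, T v) = g (0, T v) - g (v, 0) := by rw [← map_sub]; simp
    linarith
  let Λ : CompactlySupportedContinuousMap K ℝ →ₚ[ℝ] ℝ := PositiveLinearMap.mk₀
    { toFun := fun u => g (0, u.toContinuousMap)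
      map_add' := fun u u' => by
        rw [← map_add, Prod.mk_add_mk, add_zero]; rfl
      map_smul' := fun c u => by
        rw [RingHom.id_apply, ← map_smul, Prod.smul_mk, smul_zero]; rfl }
    (fun u hu => hg _ fun k => by simpa using hu k)
  refine ⟨RealRMK.rieszMeasure Λ, inferInstance, fun v => ?_⟩
  have h := RealRMK.integral_rieszMeasure Λ
    (CompactlySupportedContinuousMap.continuousMapEquiv (T v))
  exact h.trans (hgl v)

lemma re_apply_nonneg_of_norm_apply_le {d : ℕ} {X : Set (CB d)} {lam : CB d}
    (hlam : ∀ φ ∈ ballAlgSub d, ∀ r ≥ 0, (∀ x ∈ X, ‖φ x‖ ≤ r) → ‖φ lam‖ ≤ r)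
    {φ : C(CB d, ℂ)} (hφ : φ ∈ ballAlgSub d) (hpos : ∀ x ∈ X, 0 ≤ (φ x).re) :
    0 ≤ (φ lam).re := by
  by_contra! hneg
  have hsq : ∀ (t : ℝ) (z : ℂ), ‖1 - (t : ℂ) * z‖ ^ 2 = 1 - 2 * t * z.re + t ^ 2 * ‖z‖ ^ 2 := by
    intro t z
    rw [← Complex.normSq_eq_norm_sq, ← Complex.normSq_eq_norm_sq]
    simp [Complex.normSq_apply]
    ring
  set t : ℝ := -(φ lam).re / (‖φ‖ ^ 2 + 1) with ht
  have ht0 : 0 < t := div_pos (neg_pos.2 hneg) (by positivity)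
  have h := hlam (1 - (t : ℂ) • φ)
    (Subalgebra.sub_mem _ (Subalgebra.one_mem _) (Subalgebra.smul_mem _ hφ _))
    (√(1 + t ^ 2 * ‖φ‖ ^ 2)) (Real.sqrt_nonneg _) fun x hx => by
      refine Real.le_sqrt_of_sq_le ?_
      change ‖1 - (t : ℂ) * φ x‖ ^ 2 ≤ _
      rw [hsq]
      have h1 : ‖φ x‖ ^ 2 ≤ ‖φ‖ ^ 2 := pow_le_pow_left₀ (norm_nonneg _) (φ.norm_coe_le_norm x) 2
      have h2 := mul_nonneg ht0.le (hpos x hx)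
      nlinarith [mul_le_mul_of_nonneg_left h1 (sq_nonneg t)]
  change ‖1 - (t : ℂ) * φ lam‖ ≤ _ at h
  have h3 := (Real.le_sqrt (norm_nonneg _) (by positivity)).1 h
  rw [hsq] at h3
  have h4 : t * (‖φ‖ ^ 2 + 1) = -(φ lam).re := div_mul_cancel₀ _ (by positivity)
  nlinarith [mul_nonneg (sq_nonneg t) (sq_nonneg ‖φ lam‖), sq_nonneg t]

lemma exists_isRepMeasure {d : ℕ} {X : Set (CB d)} (hX : IsClosed X) {lam : CB d}
    (hlam : ∀ φ ∈ ballAlgSub d, ∀ r ≥ 0, (∀ x ∈ X, ‖φ x‖ ≤ r) → ‖φ lam‖ ≤ r) :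
    ∃ μ : Measure (CB d), IsRepMeasure d lam μ ∧ μ Xᶜ = 0 := by
  have : CompactSpace X := isCompact_iff_compactSpace.1 hX.isCompact
  let V : Submodule ℝ C(CB d, ℂ) := (Subalgebra.toSubmodule (ballAlgSub d)).restrictScalars ℝ
  let T : V →ₗ[ℝ] C(X, ℝ) :=
    { toFun := fun φ => ⟨fun x => ((φ : C(CB d, ℂ)) x).re, by fun_prop⟩
      map_add' := fun φ ψ => rfl
      map_smul' := fun c φ => by ext x; simp }
  let l : V →ₗ[ℝ] ℝ :=
    { toFun := fun φ => ((φ : C(CB d, ℂ)) lam).re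
      map_add' := fun φ ψ => rfl
      map_smul' := fun c φ => by simp }
  obtain ⟨μ, hμ, hint⟩ := exists_measure_integral_eq T l
    (v₀ := ⟨1, (ballAlgSub d).one_mem⟩) (by ext; simp [T])
    fun v hv => re_apply_nonneg_of_norm_apply_le hlam v.2 fun x hx => hv ⟨x, hx⟩
  have hre : ∀ φ ∈ ballAlgSub d, ∫ x : X, (φ x).re ∂μ = (φ lam).re :=
    fun φ hφ => hint ⟨φ, hφ⟩
  refine ⟨μ.map Subtype.val, ⟨inferInstance, inferInstance, fun φ hφ => ?_⟩, ?_⟩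
  · rw [integral_map (by fun_prop) φ.continuous.aestronglyMeasurable]
    have hφint : Integrable (fun x : X => φ x) μ :=
      (φ.continuous.comp continuous_subtype_val).integrable_of_hasCompactSupport
        (HasCompactSupport.of_compactSpace _)
    have him : ∫ x : X, (φ x).im ∂μ = (φ lam).im := by
      have h := hre ((-Complex.I) • φ) (Subalgebra.smul_mem _ hφ _)
      simpa using h
    refine Complex.ext ?_ ?_
    · rw [← hre φ hφ]
      exact integral_re hφint
    · rw [← him]
      exact integral_im hφint
  · rw [Measure.map_apply measurable_subtype_coe hX.measurableSet.compl]
    simp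

lemma apply_eq_zero_of_mem_hatSet {d : ℕ} {X : Set (CB d)} {lam : CB d} (hlam : lam ∈ hatSet d X)
    {φ : C(CB d, ℂ)} (hφ : φ ∈ IX d X) : φ lam = 0 := by
  rcases hlam with h | ⟨-, μ, hμ, hμX⟩
  · exact hφ.2 lam h
  · rw [hμ.2.2 φ hφ.1]
    refine integral_eq_zero_of_ae ?_
    filter_upwards [measure_eq_zero_iff_ae_notMem.1 hμX] with z hz
    exact hφ.2 z (not_not.1 hz)

/-- The hat of the boundary part of a zero set is the zero set of the functions vanishing there. -/
lemma hatSet_eq_ZS {d : ℕ} (hd : 1 ≤ d) {X : Set (CB d)} (hX : IsZeroSet d X) :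
    hatSet d (X ∩ sphereD d) = ZS d (IX d (X ∩ sphereD d)) := by
  obtain ⟨S, hS, rfl⟩ := hX
  set X₀ := ZS d S ∩ sphereD d with hX₀
  have hbdry : ∀ z ∈ sphereD d, z ∈ ZS d (IX d X₀) → z ∈ X₀ :=
    fun z hz h => ⟨fun φ hφ => h φ ⟨hS hφ, fun w hw => hw.1 φ hφ⟩, hz⟩
  have hclosed : IsClosed X₀ := by
    refine IsClosed.inter ?_ (isClosed_eq (by fun_prop) continuous_const)
    have : ZS d S = ⋂ φ ∈ S, {z | φ z = 0} := by
      ext z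
      simp only [ZS, mem_iInter, mem_ofPred_eq]
    rw [this]
    exact isClosed_biInter fun φ _ => isClosed_eq φ.continuous continuous_const
  refine Subset.antisymm (fun lam h φ hφ => apply_eq_zero_of_mem_hatSet h hφ) fun lam h => ?_
  rcases (mem_closedBall_zero_iff.1 lam.2).lt_or_eq with hlt | heq
  · exact Or.inr ⟨hlt, exists_isRepMeasure hclosed fun φ hφ r hr hφr =>
      norm_apply_le_of_mem_ZS_IX hd hbdry h hφ hr hφr⟩
  · exact Or.inl (hbdry lam heq h)

/-- `X̂₀` is the smallest zero set for the ball algebra containing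
`X₀ = X ∩ 𝕊_d`. -/
theorem stmt0 (d : ℕ) (hd : 1 ≤ d) (X : Set (CB d)) (hX : IsZeroSet d X) :
    IsZeroSet d (hatSet d (X ∩ sphereD d)) ∧
    X ∩ sphereD d ⊆ hatSet d (X ∩ sphereD d) ∧
    ∀ Y : Set (CB d), IsZeroSet d Y → X ∩ sphereD d ⊆ Y →
      hatSet d (X ∩ sphereD d) ⊆ Y := by
  refine ⟨⟨_, fun φ hφ => hφ.1, hatSet_eq_ZS hd hX⟩, subset_union_left, ?_⟩
  rintro _ ⟨S, hS, rfl⟩ hXS lam hlam φ hφ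
  exact apply_eq_zero_of_mem_hatSet hlam ⟨hS hφ, fun z hz => hXS hz φ hφ⟩

end
end

section
/- Let X be a zero set for the ball algebra A(𝔹_d), let X_0 = X ∩ 𝕊_d, and define X̂_0 to be the union of X_0 with the set of all points λ ∈ 𝔹_d which have a representing measure supported on X_0. Then the set X \ X̂_0 is countable and every point of X \ X̂_0 is an isolated point of X. -/
open MeasureTheory Metric Set Filter Topology

noncomputable section

section BanachRange

universe u

variable {B : Type u} [NormedAddCommGroup B] [NormedSpace ℂ B]

/-- A subspace that is the range of a bounded operator from a Banach space. -/
def IsBanachRange (V : Submodule ℂ B) : Prop :=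
  ∃ (E : Type u) (_ : NormedAddCommGroup E) (_ : NormedSpace ℂ E) (_ : CompleteSpace E)
    (T : E →L[ℂ] B), T.range = V

lemma IsBanachRange.sup {V W : Submodule ℂ B} (hV : IsBanachRange V) (hW : IsBanachRange W) :
    IsBanachRange (V ⊔ W) := by
  obtain ⟨E, _, _, _, T, rfl⟩ := hV
  obtain ⟨F, _, _, _, S, rfl⟩ := hW
  exact ⟨E × F, inferInstance, inferInstance, inferInstance, T.coprod S,
    LinearMap.range_coprod _ _⟩

lemma IsBanachRange.of_isClosed [CompleteSpace B] {V : Submodule ℂ B}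
    (hV : IsClosed (V : Set B)) : IsBanachRange V :=
  ⟨V, inferInstance, inferInstance, hV.completeSpace_coe, V.subtypeL, V.range_subtype⟩

lemma IsBanachRange.of_fg {V : Submodule ℂ B} (hV : V.FG) : IsBanachRange V := by
  have : FiniteDimensional ℂ V := .of_fg hV
  exact ⟨V, inferInstance, inferInstance, FiniteDimensional.complete ℂ V, V.subtypeL,
    V.range_subtype⟩

lemma IsBanachRange.isClosed_of_coFG [CompleteSpace B] {R : Submodule ℂ B} (hR : IsBanachRange R)
    (hRfin : R.CoFG) : IsClosed (R : Set B) := by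
  obtain ⟨G, hG⟩ := Submodule.exists_isCompl R
  have : FiniteDimensional ℂ G := .of_fg (Submodule.CoFG.fg_of_isCompl hG hRfin)
  have : CompleteSpace G := FiniteDimensional.complete ℂ G
  obtain ⟨E, _, _, _, T, rfl⟩ := hR
  have hsurj : Function.Surjective (T.coprod G.subtypeL) := by
    refine LinearMap.range_eq_top.1 ?_
    exact (LinearMap.range_coprod _ _).trans (by simpa using hG.sup_eq_top)
  rw [← ((T.coprod G.subtypeL).isQuotientMap hsurj).isClosed_preimage]
  suffices h : T.coprod G.subtypeL ⁻¹' (T.range : Set B) = Prod.snd ⁻¹' {(0 : G)} by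
    rw [h]
    exact isClosed_singleton.preimage continuous_snd
  ext ⟨e, g⟩
  have hmem : T e + g ∈ T.range ↔ (g : B) ∈ T.range :=
    Submodule.add_mem_iff_right _ (LinearMap.mem_range_self _ e)
  have hzero : (g : B) ∈ T.range ↔ g = 0 := by
    refine ⟨fun h => Subtype.ext (Submodule.disjoint_def.1 hG.disjoint _ h g.2), ?_⟩
    rintro rfl
    exact zero_mem _
  exact hmem.trans hzero

lemma IsBanachRange.exists_preimage_norm_le [CompleteSpace B] {V : Submodule ℂ B}
    (hV : IsBanachRange V) {D : Type u} [NormedAddCommGroup D] [NormedSpace ℂ D]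
    [CompleteSpace D] (U : D →L[ℂ] B) (hR : IsClosed ((U.range ⊔ V : Submodule ℂ B) : Set B)) :
    ∃ C > 0, ∀ y ∈ U.range ⊔ V, ∃ b, y - U b ∈ V ∧ ‖b‖ ≤ C * ‖y‖ := by
  obtain ⟨E, _, _, _, T, rfl⟩ := hV
  set R := U.range ⊔ T.range with hRdef
  have : CompleteSpace R := hR.completeSpace_coe
  have hr : (U.coprod T).range = R := LinearMap.range_coprod _ _
  let S : D × E →L[ℂ] R := (U.coprod T).codRestrict R fun p => hr ▸ LinearMap.mem_range_self _ p
  have hS : Function.Surjective S := by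
    rintro ⟨y, hy⟩
    obtain ⟨p, hp⟩ := hr.symm ▸ hy
    exact ⟨p, Subtype.ext hp⟩
  obtain ⟨C, hC, h⟩ := S.exists_preimage_norm_le hS
  refine ⟨C, hC, fun y hy => ?_⟩
  obtain ⟨p, hp, hn⟩ := h ⟨y, hy⟩
  refine ⟨p.1, ?_, (norm_fst_le p).trans hn⟩
  have : y = U p.1 + T p.2 := (congrArg Subtype.val hp).symm
  rw [this, add_sub_cancel_left]
  exact ⟨_, rfl⟩

end BanachRange

section BanachAlgebra

universe u

variable {B : Type u} [NormedCommRing B] [NormedAlgebra ℂ B] [CompleteSpace B]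

omit [CompleteSpace B] in
lemma range_mul_eq (x : B) :
    (ContinuousLinearMap.mul ℂ B x).range = (Ideal.span {x}).restrictScalars ℂ := by
  ext y
  simp [Ideal.mem_span_singleton, dvd_def, eq_comm]

lemma IsBanachRange.sup_span_singleton {J : Ideal B} (hJ : IsBanachRange (J.restrictScalars ℂ))
    (x : B) : IsBanachRange ((J ⊔ Ideal.span {x}).restrictScalars ℂ) := by
  rw [Submodule.restrictScalars_sup]
  exact hJ.sup ⟨B, inferInstance, inferInstance, inferInstance, _, range_mul_eq x⟩

/-- The elements carried into `J` by some power of `x`. -/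
def powColon (J : Ideal B) (x : B) : Ideal B where
  carrier := {b | ∃ n, x ^ n * b ∈ J}
  zero_mem' := ⟨0, by simp⟩
  add_mem' := by
    rintro a b ⟨n, hn⟩ ⟨m, hm⟩
    refine ⟨n + m, ?_⟩
    convert J.add_mem (J.mul_mem_left (x ^ m) hn) (J.mul_mem_left (x ^ n) hm) using 1
    ring
  smul_mem' := by
    rintro c b ⟨n, hn⟩
    refine ⟨n, ?_⟩
    convert J.mul_mem_left c hn using 1
    simp only [smul_eq_mul]
    ring

omit [NormedAlgebra ℂ B] [CompleteSpace B] in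
lemma mem_powColon_of_mul_mem {J : Ideal B} {x b : B} (h : x * b ∈ powColon J x) :
    b ∈ powColon J x := by
  obtain ⟨n, hn⟩ := h
  exact ⟨n + 1, by convert hn using 1; ring⟩

lemma Submodule.CoFG.exists_fg_sup_eq {E : Type*} [AddCommGroup E] [Module ℂ E]
    {Q : Submodule ℂ E} (hQ : Q.CoFG) (K : Submodule ℂ E) :
    ∃ F : Submodule ℂ E, F.FG ∧ F ≤ K ∧ Q ⊔ F = Q ⊔ K := by
  obtain ⟨G, hG⟩ := Submodule.exists_isCompl (Q ⊓ K)
  refine ⟨G ⊓ K, Submodule.CoFG.fg_of_disjoint (T := Q) ?_ hQ, inf_le_right, ?_⟩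
  · rw [disjoint_iff, inf_assoc, inf_comm K, ← disjoint_iff]
    exact hG.symm.disjoint
  · refine le_antisymm (sup_le_sup_left inf_le_right _) (sup_le le_sup_left ?_)
    have : K = (Q ⊓ K) ⊔ (G ⊓ K) := by
      rw [← sup_inf_assoc_of_le G (inf_le_right : Q ⊓ K ≤ K), hG.sup_eq_top, top_inf_eq]
    calc K = (Q ⊓ K) ⊔ (G ⊓ K) := this
      _ ≤ _ := sup_le_sup_right inf_le_left _

/-- If `J + (x)` has finite codimension and `x` is a limit of elements `x - c` invertible modulo
`J`, then some element congruent to `1` modulo `x` is carried into `J` by a power of `x`. -/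
lemma exists_pow_mul_mem_of_coFG {J : Ideal B} (hJ : IsBanachRange (J.restrictScalars ℂ)) {x : B}
    (hfin : ((J ⊔ Ideal.span {x}).restrictScalars ℂ).CoFG)
    (hx : ∀ ε > 0, ∃ c : ℂ, ‖c‖ < ε ∧ ∃ u, (x - algebraMap ℂ B c) * u - 1 ∈ J) :
    ∃ n k, x ^ n * k ∈ J ∧ 1 - k ∈ Ideal.span {x} := by
  set K := powColon J x with hK
  have hJK : J ≤ K := fun b hb => ⟨0, by simpa using hb⟩
  obtain ⟨F, hFfg, hFK, hF⟩ := hfin.exists_fg_sup_eq (K.restrictScalars ℂ)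
  set V := J.restrictScalars ℂ ⊔ F with hVdef
  have hV : IsBanachRange V := hJ.sup (.of_fg hFfg)
  have hVK : V ≤ K.restrictScalars ℂ := sup_le hJK hFK
  let U : B →L[ℂ] B := ContinuousLinearMap.mul ℂ B x
  have hRV : U.range ⊔ V = (Ideal.span {x} ⊔ K).restrictScalars ℂ := by
    rw [Submodule.restrictScalars_sup] at hF
    rw [range_mul_eq, hVdef, ← sup_assoc, sup_comm (Submodule.restrictScalars ℂ (Ideal.span {x})),
      hF, Submodule.restrictScalars_sup, sup_comm (J.restrictScalars ℂ), sup_assoc]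
    congr 1
    exact sup_eq_right.2 hJK
  have hclosed : IsClosed ((U.range ⊔ V : Submodule ℂ B) : Set B) := by
    refine IsBanachRange.isClosed_of_coFG (IsBanachRange.sup
      ⟨B, inferInstance, inferInstance, inferInstance, _, rfl⟩ hV) (Submodule.CoFG.of_le ?_ hfin)
    rw [hRV]
    exact sup_le (hJK.trans le_sup_right) le_sup_left
  obtain ⟨C, hC, hCb⟩ := hV.exists_preimage_norm_le U hclosed
  rw [hRV] at hclosed hCb
  have key : ∀ b, ∀ k ∈ K, ∃ k' ∈ K, ‖b - k'‖ ≤ C * ‖x * b - k‖ := by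
    intro b k hk
    obtain ⟨e, he, hen⟩ := hCb (x * b - k) (sub_mem
      (Ideal.mem_sup_left (Ideal.mul_mem_right _ _ (Ideal.mem_span_singleton_self x)))
      (Ideal.mem_sup_right hk))
    refine ⟨b - e, mem_powColon_of_mul_mem ?_, by simpa using hen⟩
    convert K.add_mem (hVK he) hk using 1
    simp only [U, ContinuousLinearMap.mul_apply']
    ring
  have h1 : (1 : B) ∈ ((Ideal.span {x} ⊔ K).restrictScalars ℂ : Submodule ℂ B) := by
    rw [← SetLike.mem_coe, ← hclosed.closure_eq]
    refine Metric.mem_closure_iff.2 fun ε hε => ?_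
    set D := 2 * C * ‖(1 : B)‖ + 1 with hD
    have hDpos : 0 < D := by positivity
    obtain ⟨c, hc, u, hu⟩ := hx (min (1 / (2 * C)) (ε / D)) (by positivity)
    have hc1 : ‖c‖ * C ≤ 1 / 2 := by
      have := (hc.trans_le (min_le_left _ _)).le
      rw [le_div_iff₀ (by positivity)] at this
      linarith
    have hc2 : ‖c‖ * D < ε := by
      have := hc.trans_le (min_le_right _ _)
      rwa [lt_div_iff₀ hDpos] at this
    set j := (x - algebraMap ℂ B c) * u - 1 with hj
    have hxu : x * u = 1 + c • u + j := by
      rw [hj, Algebra.smul_def]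
      ring
    have hdist : Metric.infDist u (K : Set B) ≤ 2 * C * ‖(1 : B)‖ := by
      by_contra! hlt
      set δ := Metric.infDist u (K : Set B) with hδ
      have hKne : (K : Set B).Nonempty := ⟨0, K.zero_mem⟩
      obtain ⟨k, hk, hkd⟩ :=
        (Metric.infDist_lt_iff (x := u) hKne (r := δ + (δ - 2 * C * ‖(1 : B)‖))).1
        (by linarith)
      obtain ⟨k', hk', hn⟩ := key u (c • k + j) (K.add_mem (Submodule.smul_of_tower_mem K c hk)
        (hJK hu))
      have h2 : δ ≤ ‖u - k'‖ := by
        rw [← dist_eq_norm]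
        exact Metric.infDist_le_dist_of_mem hk'
      have h3 : x * u - (c • k + j) = 1 + c • (u - k) := by
        rw [hxu, smul_sub]
        abel
      have h4 : ‖x * u - (c • k + j)‖ ≤ ‖(1 : B)‖ + ‖c‖ * ‖u - k‖ := by
        rw [h3, ← norm_smul]
        exact norm_add_le _ _
      rw [dist_eq_norm] at hkd
      have h5 : C * (‖c‖ * ‖u - k‖) ≤ 1 / 2 * ‖u - k‖ := by
        calc C * (‖c‖ * ‖u - k‖) = (‖c‖ * C) * ‖u - k‖ := by ring
          _ ≤ _ := by gcongr
      have h6 : C * ‖x * u - (c • k + j)‖ ≤ C * (‖(1 : B)‖ + ‖c‖ * ‖u - k‖) := by gcongr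
      linarith
    obtain ⟨k, hk, hkd⟩ := (Metric.infDist_lt_iff (x := u) ⟨0, K.zero_mem⟩ (r := D)).1
        (by linarith)
    refine ⟨x * u - (c • k + j), sub_mem
      (Ideal.mem_sup_left (Ideal.mul_mem_right _ _ (Ideal.mem_span_singleton_self x)))
      (Ideal.mem_sup_right (K.add_mem (Submodule.smul_of_tower_mem K c hk) (hJK hu))), ?_⟩
    rw [dist_eq_norm] at hkd ⊢
    have h3 : 1 - (x * u - (c • k + j)) = -(c • (u - k)) := by
      rw [hxu, smul_sub]
      abel
    rw [h3, norm_neg, norm_smul]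
    calc ‖c‖ * ‖u - k‖ ≤ ‖c‖ * D := by gcongr
      _ < ε := hc2
  obtain ⟨a, ha, k, ⟨n, hn⟩, hak⟩ :=
    Submodule.mem_sup.1 ((Submodule.restrictScalars_mem _ _ _).1 h1)
  exact ⟨n, k, hn, by rwa [← hak, add_sub_cancel_right]⟩

omit [CompleteSpace B] in
lemma coFG_of_pow_mem {J : Ideal B} {x : B}
    (hfin : ((J ⊔ Ideal.span {x}).restrictScalars ℂ).CoFG) {n : ℕ} (hn : x ^ n ∈ J) :
    (J.restrictScalars ℂ).CoFG := by
  obtain ⟨F, hFfg, -, hF⟩ := hfin.exists_fg_sup_eq ⊤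
  rw [sup_top_eq] at hF
  have key : ∀ m, ∃ G : Submodule ℂ B, G.FG ∧
      (J ⊔ Ideal.span {x ^ m}).restrictScalars ℂ ⊔ G = ⊤ := by
    intro m
    induction m with
    | zero => exact ⟨⊥, Submodule.fg_bot, by simp⟩
    | succ m ih =>
      obtain ⟨G, hGfg, hG⟩ := ih
      refine ⟨F.map (LinearMap.mul ℂ B (x ^ m)) ⊔ G, (hFfg.map _).sup hGfg, ?_⟩
      rw [eq_top_iff, ← hG, ← sup_assoc]
      refine sup_le_sup_right ?_ _
      intro y hy
      obtain ⟨j, hj, a, ha, rfl⟩ := Submodule.mem_sup.1 ((Submodule.restrictScalars_mem _ _ _).1 hy)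
      obtain ⟨b, rfl⟩ := Ideal.mem_span_singleton.1 ha
      obtain ⟨c, hc, f, hf, rfl⟩ := Submodule.mem_sup.1 (hF ▸ Submodule.mem_top : b ∈ _)
      obtain ⟨j', hj', e, he, rfl⟩ :=
        Submodule.mem_sup.1 ((Submodule.restrictScalars_mem _ _ _).1 hc)
      obtain ⟨t, rfl⟩ := Ideal.mem_span_singleton.1 he
      refine Submodule.mem_sup.2 ⟨(j + x ^ m * j') + x ^ (m + 1) * t, ?_, x ^ m * f,
        ⟨f, hf, rfl⟩, by ring⟩
      exact Submodule.add_mem_sup (J.add_mem hj (J.mul_mem_left _ hj'))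
        (Ideal.mem_span_singleton.2 ⟨t, rfl⟩)
  obtain ⟨G, hGfg, hG⟩ := key n
  rw [sup_eq_left.2 ((Ideal.span_singleton_le_iff_mem _).2 hn)] at hG
  exact Submodule.FG.cofg_of_codisjoint (codisjoint_iff.2 (by rwa [sup_comm] at hG)) hGfg

lemma coFG_of_local {ι : Type*} (χ : B →ₐ[ℂ] ℂ) (z : ι → B) (hz : ∀ i, χ (z i) = 0)
    (s : Finset ι) (J : Ideal B) (hJ : IsBanachRange (J.restrictScalars ℂ))
    (hloc : ∀ b, χ b ≠ 0 → ∃ u, b * u - 1 ∈ J)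
    (hfin : ((J ⊔ Ideal.span (z '' s)).restrictScalars ℂ).CoFG) :
    (J.restrictScalars ℂ).CoFG := by
  classical
  induction s using Finset.induction_on generalizing J with
  | empty => simpa using hfin
  | insert i s _ ih =>
    have hfin' : ((J ⊔ Ideal.span {z i}).restrictScalars ℂ).CoFG := by
      refine ih _ (hJ.sup_span_singleton _) (fun b hb => ?_) ?_
      · obtain ⟨u, hu⟩ := hloc b hb
        exact ⟨u, Ideal.mem_sup_left hu⟩
      · rwa [Finset.coe_insert, Set.image_insert_eq, Ideal.span_insert, ← sup_assoc] at hfin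
    obtain ⟨n, k, hnk, hk⟩ := exists_pow_mul_mem_of_coFG hJ hfin' (fun ε hε => by
      refine ⟨((ε / 2 : ℝ) : ℂ), ?_, hloc _ ?_⟩
      · rw [Complex.norm_real, Real.norm_of_nonneg (by positivity)]
        linarith
      · rw [map_sub, hz, AlgHom.commutes, zero_sub, neg_ne_zero]
        simpa using hε.ne')
    obtain ⟨t, ht⟩ := Ideal.mem_span_singleton.1 hk
    have hχ : χ k = 1 := by
      have := congrArg χ ht
      rw [map_sub, map_mul, hz, zero_mul, map_one, sub_eq_zero] at this
      exact this.symm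
    obtain ⟨u, hu⟩ := hloc k (by simp [hχ])
    refine coFG_of_pow_mem hfin' (n := n) ?_
    convert J.sub_mem (J.mul_mem_right u hnk) (J.mul_mem_left (z i ^ n) hu) using 1
    ring

/-- A boundary point of the maximal ideal space of `B ⧸ I` whose maximal ideal is finitely
generated is isolated, in algebraic form. -/
lemma exists_pow_mul_mem {ι : Type*} [Fintype ι] (χ : B →ₐ[ℂ] ℂ) (z : ι → B)
    (hz : RingHom.ker χ = Ideal.span (Set.range z)) {I : Ideal B} (hI : IsClosed (I : Set B))
    {x : B} (hloc : ∀ b, χ b ≠ 0 → ∃ u, b * u - 1 ∈ I ⊔ Ideal.span {x}) (hx : χ x = 0)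
    (hbd : ∀ ε > 0, ∃ c : ℂ, ‖c‖ < ε ∧ ∃ u, (x - algebraMap ℂ B c) * u - 1 ∈ I) :
    ∃ n k, x ^ n * k ∈ I ∧ χ k = 1 := by
  have hI' : IsBanachRange (I.restrictScalars ℂ) := .of_isClosed hI
  have hker : ((RingHom.ker χ).restrictScalars ℂ).CoFG :=
    Submodule.CoFG.ker (χ.toLinearMap : B →ₗ[ℂ] ℂ)
  have hfin : ((I ⊔ Ideal.span {x}).restrictScalars ℂ).CoFG := by
    refine coFG_of_local χ z (fun i => ?_) Finset.univ _ (hI'.sup_span_singleton x) hloc ?_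
    · rw [← RingHom.mem_ker, hz]
      exact Ideal.subset_span ⟨i, rfl⟩
    · refine Submodule.CoFG.of_le ?_ hker
      rw [hz, Finset.coe_univ, Set.image_univ]
      exact fun y hy => Ideal.mem_sup_right hy
  obtain ⟨n, k, hnk, hk⟩ := exists_pow_mul_mem_of_coFG hI' hfin hbd
  obtain ⟨t, ht⟩ := Ideal.mem_span_singleton.1 hk
  have := congrArg χ ht
  rw [map_sub, map_mul, hx, zero_mul, map_one, sub_eq_zero] at this
  exact ⟨n, k, hnk, this.symm⟩

end BanachAlgebra

section Polydisc

open WeakDual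

/-- The closed unit polydisc. -/
abbrev Polydisc (d : ℕ) : Set (Fin d → ℂ) := Metric.closedBall 0 1

instance (d : ℕ) : CompactSpace (Polydisc d) :=
  isCompact_iff_compactSpace.mp (isCompact_closedBall _ _)

variable {d : ℕ}

lemma mem_polydisc {z : Fin d → ℂ} : z ∈ Polydisc d ↔ ∀ i, ‖z i‖ ≤ 1 := by
  simp [pi_norm_le_iff_of_nonneg]

instance : Zero (Polydisc d) := ⟨⟨0, by simp⟩⟩

/-- The coordinate functions on the polydisc. -/
def polydiscCoordFun (i : Fin d) : C(Polydisc d, ℂ) :=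
  ⟨fun z => (z : Fin d → ℂ) i, (continuous_apply i).comp continuous_subtype_val⟩

/-- The polydisc algebra: uniform limits of polynomials on the closed polydisc. -/
def polydiscAlg (d : ℕ) : Subalgebra ℂ C(Polydisc d, ℂ) :=
  (Algebra.adjoin ℂ (Set.range (polydiscCoordFun (d := d)))).topologicalClosure

lemma isClosed_polydiscAlg : IsClosed (polydiscAlg d : Set C(Polydisc d, ℂ)) :=
  Subalgebra.isClosed_topologicalClosure _

instance : NormedCommRing (polydiscAlg d) := (polydiscAlg d).normedCommRing

instance : NormedAlgebra ℂ (polydiscAlg d) := Subalgebra.toNormedAlgebra _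

instance : NormOneClass (polydiscAlg d) := ⟨norm_one (α := C(Polydisc d, ℂ))⟩

instance : CompleteSpace (polydiscAlg d) := isClosed_polydiscAlg.completeSpace_coe

lemma polydiscCoordFun_mem (i : Fin d) : polydiscCoordFun i ∈ polydiscAlg d :=
  Subalgebra.le_topologicalClosure _ (Algebra.subset_adjoin ⟨i, rfl⟩)

/-- The coordinate functions as elements of the polydisc algebra. -/
def polydiscCoord (i : Fin d) : polydiscAlg d := ⟨_, polydiscCoordFun_mem i⟩

/-- Evaluation of elements of the polydisc algebra at a point. -/
def polydiscEval (z : Polydisc d) : polydiscAlg d →ₐ[ℂ] ℂ :=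
  (ContinuousMap.evalAlgHom ℂ ℂ z).comp (polydiscAlg d).val

lemma polydiscEval_apply (z : Polydisc d) (f : polydiscAlg d) :
    polydiscEval z f = (f : C(Polydisc d, ℂ)) z := rfl

lemma polydiscEval_coord (z : Polydisc d) (i : Fin d) :
    polydiscEval z (polydiscCoord i) = (z : Fin d → ℂ) i := rfl

lemma continuous_polydiscEval (z : Polydisc d) : Continuous (polydiscEval z) :=
  (continuous_eval_const z).comp continuous_subtype_val

lemma polydiscAlg_induction {C : polydiscAlg d → Prop} (hC : IsClosed {f | C f})
    (hcoord : ∀ i, C (polydiscCoord i)) (halg : ∀ c, C (algebraMap ℂ _ c))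
    (hadd : ∀ f g, C f → C g → C (f + g)) (hmul : ∀ f g, C f → C g → C (f * g)) (f) : C f := by
  set A₀ := Algebra.adjoin ℂ (Set.range (polydiscCoordFun (d := d))) with hA₀
  have hle : A₀ ≤ polydiscAlg d := Subalgebra.le_topologicalClosure _
  have hpoly : ∀ g (hg : g ∈ A₀), C ⟨g, hle hg⟩ := by
    intro g hg
    induction hg using Algebra.adjoin_induction with
    | mem g hg =>
      obtain ⟨i, rfl⟩ := hg
      exact hcoord i
    | algebraMap c => exact halg c
    | add f g hf hg ihf ihg => exact hadd _ _ ihf ihg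
    | mul f g hf hg ihf ihg => exact hmul _ _ ihf ihg
  have hcl : f ∈ closure (Subtype.val ⁻¹' (A₀ : Set C(Polydisc d, ℂ)) : Set (polydiscAlg d)) := by
    rw [Topology.IsEmbedding.subtypeVal.closure_eq_preimage_closure_image]
    have himage : Subtype.val '' (Subtype.val ⁻¹' (A₀ : Set C(Polydisc d, ℂ)) :
        Set (polydiscAlg d)) = A₀ :=
      (Subtype.image_preimage_coe _ _).trans (Set.inter_eq_right.2 hle)
    rw [himage]
    exact f.2
  exact closure_minimal (t := {f | C f}) (fun g hg => hpoly _ hg) hC hcl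

lemma polydiscAlg_algHom_ext {φ ψ : polydiscAlg d →ₐ[ℂ] ℂ} (hφ : Continuous φ)
    (hψ : Continuous ψ) (h : ∀ i, φ (polydiscCoord i) = ψ (polydiscCoord i)) : φ = ψ := by
  ext f
  refine polydiscAlg_induction (C := fun f => φ f = ψ f) (isClosed_eq hφ hψ) h (fun c => ?_)
    (fun f g hf hg => ?_) (fun f g hf hg => ?_) f
  · simp
  · simp only [map_add, hf, hg]
  · simp only [map_mul, hf, hg]

/-- The nullstellensatz for the polydisc algebra. -/
lemma exists_common_zero_of_ne_top {J : Ideal (polydiscAlg d)} (hJ : J ≠ ⊤) :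
    ∃ z : Polydisc d, ∀ f ∈ J, polydiscEval z f = 0 := by
  obtain ⟨M, hM, hJM⟩ := J.exists_le_maximal hJ
  let χ := M.toCharacterSpace
  have hχ : Continuous (CharacterSpace.toAlgHom χ) := map_continuous χ
  have hbound : ∀ i, ‖χ (polydiscCoord i)‖ ≤ 1 := by
    intro i
    refine (AlgHom.norm_apply_le_self (CharacterSpace.toAlgHom χ) (polydiscCoord i)).trans ?_
    exact (ContinuousMap.norm_le _ zero_le_one).2 fun z => mem_polydisc.1 z.2 i
  refine ⟨⟨fun i => χ (polydiscCoord i), mem_polydisc.2 hbound⟩, fun f hf => ?_⟩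
  rw [← polydiscAlg_algHom_ext hχ (continuous_polydiscEval _) fun i => rfl]
  exact M.toCharacterSpace_apply_eq_zero_of_mem (hJM hf)

lemma exists_aeval_eq (z : Polydisc d) (i : Fin d) (f : C(Polydisc d, ℂ))
    (hf : f ∈ Algebra.adjoin ℂ (Set.range (polydiscCoordFun (d := d)))) :
    ∃ g : ℂ → ℂ, Differentiable ℂ g ∧ ∀ w : Polydisc d,
      (∀ j ≠ i, (w : Fin d → ℂ) j = (z : Fin d → ℂ) j) → f w = g ((w : Fin d → ℂ) i) := by
  induction hf using Algebra.adjoin_induction with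
  | mem g hg =>
    obtain ⟨j, rfl⟩ := hg
    by_cases hj : j = i
    · subst hj
      exact ⟨id, differentiable_id, fun w _ => rfl⟩
    · exact ⟨fun _ => (z : Fin d → ℂ) j, differentiable_const _, fun w hw => hw j hj⟩
  | algebraMap c => exact ⟨fun _ => c, differentiable_const _, fun w _ => rfl⟩
  | add f g _ _ ihf ihg =>
    obtain ⟨F, hF, hF'⟩ := ihf
    obtain ⟨G, hG, hG'⟩ := ihg
    exact ⟨F + G, hF.add hG, fun w hw => by simp [hF' w hw, hG' w hw]⟩
  | mul f g _ _ ihf ihg =>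
    obtain ⟨F, hF, hF'⟩ := ihf
    obtain ⟨G, hG, hG'⟩ := ihg
    exact ⟨F * G, hF.mul hG, fun w hw => by simp [hF' w hw, hG' w hw]⟩

lemma norm_le_norm_coord_mul (i : Fin d) (f : polydiscAlg d) :
    ‖f‖ ≤ ‖polydiscCoord i * f‖ := by
  suffices h : ∀ f ∈ polydiscAlg d, ‖f‖ ≤ ‖polydiscCoordFun i * f‖ from h f f.2
  intro f hf
  have hclosed : IsClosed {f : C(Polydisc d, ℂ) | ‖f‖ ≤ ‖polydiscCoordFun i * f‖} :=
    isClosed_le continuous_norm (continuous_const.mul continuous_id).norm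
  refine closure_minimal (fun f hf => ?_) hclosed hf
  refine (ContinuousMap.norm_le _ (norm_nonneg _)).2 fun z => ?_
  obtain ⟨g, hg, hfg⟩ := exists_aeval_eq z i f hf
  rw [hfg z fun _ _ => rfl]
  have hz : (z : Fin d → ℂ) i ∈ closure (Metric.ball (0 : ℂ) 1) := by
    rw [closure_ball _ one_ne_zero, mem_closedBall_zero_iff]
    exact mem_polydisc.1 z.2 i
  refine Complex.norm_le_of_forall_mem_frontier_norm_le Metric.isBounded_ball hg.diffContOnCl
    (fun w hw => ?_) hz
  rw [frontier_ball _ one_ne_zero, mem_sphere_zero_iff_norm] at hw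
  have hw' : Function.update (z : Fin d → ℂ) i w ∈ Polydisc d := by
    refine mem_polydisc.2 fun j => ?_
    rcases eq_or_ne j i with rfl | hj
    · simp [hw]
    · simpa [hj] using mem_polydisc.1 z.2 j
  have := (polydiscCoordFun i * f).norm_coe_le_norm ⟨_, hw'⟩
  rwa [ContinuousMap.mul_apply, hfg ⟨_, hw'⟩ fun j hj => by simp [hj], norm_mul,
    show polydiscCoordFun i ⟨_, hw'⟩ = w by simp [polydiscCoordFun], hw, one_mul,
    show ((⟨_, hw'⟩ : Polydisc d) : Fin d → ℂ) i = w by simp] at this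

lemma isClosed_span_coord (i : Fin d) :
    IsClosed (Ideal.span {polydiscCoord i} : Set (polydiscAlg d)) := by
  let U : polydiscAlg d →L[ℂ] polydiscAlg d := ContinuousLinearMap.mul ℂ _ (polydiscCoord i)
  have hU : AntilipschitzWith 1 U :=
    AddMonoidHomClass.antilipschitz_of_bound U fun f =>
      (norm_le_norm_coord_mul i f).trans_eq (one_mul _).symm
  have hrange : Set.range U = Ideal.span {polydiscCoord i} :=
    congrArg ((↑) : Submodule ℂ (polydiscAlg d) → Set (polydiscAlg d))
      (range_mul_eq (polydiscCoord i))
  rw [← hrange]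
  exact hU.isClosed_range U.uniformContinuous

/-- Setting the coordinates in `s` to zero. -/
def zeroOut (s : Finset (Fin d)) : C(Polydisc d, Polydisc d) where
  toFun z := ⟨fun j => if j ∈ s then 0 else (z : Fin d → ℂ) j, mem_polydisc.2 fun j => by
    split_ifs
    · simp
    · exact mem_polydisc.1 z.2 j⟩
  continuous_toFun := by
    refine Continuous.subtype_mk (continuous_pi fun j => ?_) _
    split_ifs
    · exact continuous_const
    · exact (continuous_apply j).comp continuous_subtype_val

lemma comp_zeroOut_mem (s : Finset (Fin d)) (f : polydiscAlg d) :
    (f : C(Polydisc d, ℂ)).comp (zeroOut s) ∈ polydiscAlg d := by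
  have hclosed : IsClosed {f : polydiscAlg d |
      (f : C(Polydisc d, ℂ)).comp (zeroOut s) ∈ polydiscAlg d} :=
    isClosed_polydiscAlg.preimage
      ((ContinuousMap.continuous_precomp (zeroOut s)).comp continuous_subtype_val)
  refine polydiscAlg_induction
    (C := fun f => (f : C(Polydisc d, ℂ)).comp (zeroOut s) ∈ polydiscAlg d) hclosed
    (fun i => ?_) (fun c => ?_) (fun f g hf hg => ?_) (fun f g hf hg => ?_) f
  · by_cases hi : i ∈ s
    · convert (polydiscAlg d).zero_mem using 1
      ext z
      simp [polydiscCoord, polydiscCoordFun, zeroOut, hi]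
    · convert polydiscCoordFun_mem i using 1
      ext z
      simp [polydiscCoord, polydiscCoordFun, zeroOut, hi]
  · exact (polydiscAlg d).algebraMap_mem c
  · exact (polydiscAlg d).add_mem hf hg
  · exact (polydiscAlg d).mul_mem hf hg

/-- Composition with `zeroOut s` on the polydisc algebra. -/
def compZeroOut (s : Finset (Fin d)) (f : polydiscAlg d) : polydiscAlg d :=
  ⟨_, comp_zeroOut_mem s f⟩

lemma continuous_compZeroOut (s : Finset (Fin d)) : Continuous (compZeroOut s) :=
  ((ContinuousMap.continuous_precomp _).comp continuous_subtype_val).subtype_mk _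

lemma sub_compZeroOut_singleton_mem (i : Fin d) (f : polydiscAlg d) :
    f - compZeroOut {i} f ∈ Ideal.span {polydiscCoord i} := by
  refine polydiscAlg_induction
    (C := fun f => f - compZeroOut {i} f ∈ Ideal.span {polydiscCoord i})
    ((isClosed_span_coord i).preimage (continuous_id.sub (continuous_compZeroOut _)))
    (fun j => ?_) (fun c => ?_) (fun f g hf hg => ?_) (fun f g hf hg => ?_) f
  · by_cases hj : j = i
    · subst hj
      convert Ideal.mem_span_singleton_self (polydiscCoord j) using 1
      ext z
      simp [compZeroOut, polydiscCoord, polydiscCoordFun, zeroOut]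
    · convert Ideal.zero_mem _ using 1
      ext z
      simp [compZeroOut, polydiscCoord, polydiscCoordFun, zeroOut, hj]
  · convert Ideal.zero_mem _ using 1
    exact sub_self _
  · convert add_mem hf hg using 1
    rw [show compZeroOut {i} (f + g) = compZeroOut {i} f + compZeroOut {i} g from rfl]
    ring
  · convert add_mem (Ideal.mul_mem_left _ g hf) (Ideal.mul_mem_left _ (compZeroOut {i} f) hg)
      using 1
    rw [show compZeroOut {i} (f * g) = compZeroOut {i} f * compZeroOut {i} g from rfl]
    ring

/-- Gleason's problem for the polydisc algebra: the coordinates generate the maximal ideal of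
the origin. -/
lemma ker_polydiscEval_zero :
    RingHom.ker (polydiscEval (0 : Polydisc d)) = Ideal.span (Set.range polydiscCoord) := by
  apply le_antisymm
  · intro f hf
    have key : ∀ s : Finset (Fin d), f - compZeroOut s f ∈ Ideal.span (Set.range polydiscCoord) := by
      intro s
      induction s using Finset.induction_on with
      | empty =>
        convert Ideal.zero_mem _ using 1
        exact sub_self _
      | insert i s _ ih =>
        have h : compZeroOut {i} (compZeroOut s f) = compZeroOut (insert i s) f := by
          ext z
          change (f : C(Polydisc d, ℂ)) _ = (f : C(Polydisc d, ℂ)) _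
          congr 1
          ext j
          simp only [zeroOut, ContinuousMap.coe_mk, Finset.mem_singleton, Finset.mem_insert]
          split_ifs <;> tauto
        have h2 := Ideal.span_mono (Set.singleton_subset_iff.2 (Set.mem_range_self (f := polydiscCoord) i))
          (sub_compZeroOut_singleton_mem i (compZeroOut s f))
        rw [h] at h2
        simpa using add_mem ih h2
    have h0 : compZeroOut Finset.univ f = 0 := by
      ext z
      rw [RingHom.mem_ker, polydiscEval_apply] at hf
      refine Eq.trans ?_ hf
      change (f : C(Polydisc d, ℂ)) _ = (f : C(Polydisc d, ℂ)) _
      congr 1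
      ext j
      simp [zeroOut]
    simpa [h0] using key Finset.univ
  · rw [Ideal.span_le]
    rintro _ ⟨i, rfl⟩
    exact polydiscEval_coord 0 i

/-- The ideal of elements of the polydisc algebra vanishing on `Y`. -/
def polydiscIdeal (Y : Set (Polydisc d)) : Ideal (polydiscAlg d) :=
  ⨅ z ∈ Y, RingHom.ker (polydiscEval z)

lemma mem_polydiscIdeal {Y : Set (Polydisc d)} {f : polydiscAlg d} :
    f ∈ polydiscIdeal Y ↔ ∀ z ∈ Y, polydiscEval z f = 0 := by
  simp [polydiscIdeal, RingHom.mem_ker]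

lemma isClosed_polydiscIdeal (Y : Set (Polydisc d)) :
    IsClosed (polydiscIdeal Y : Set (polydiscAlg d)) := by
  have : (polydiscIdeal Y : Set (polydiscAlg d)) = ⋂ z ∈ Y, {f | polydiscEval z f = 0} := by
    ext f
    simp [mem_polydiscIdeal]
  rw [this]
  exact isClosed_biInter fun z _ => isClosed_eq (continuous_polydiscEval z) continuous_const

/-- If a function in the polydisc algebra vanishes on a zero set `Y` exactly at the origin and
omits arbitrarily small values on `Y`, then the origin is isolated in `Y`. -/
lemma eventually_eq_zero_of_zeroSet {S : Set (polydiscAlg d)} {Y : Set (Polydisc d)}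
    (hY : ∀ z, z ∈ Y ↔ ∀ f ∈ S, polydiscEval z f = 0)
    {x : polydiscAlg d} (hx0 : polydiscEval 0 x = 0) (hx : ∀ z ∈ Y, polydiscEval z x = 0 → z = 0)
    (hbd : ∀ ε > 0, ∃ c : ℂ, ‖c‖ < ε ∧ ∀ z ∈ Y, polydiscEval z x ≠ c) :
    ∀ᶠ z in 𝓝 (0 : Polydisc d), z ∈ Y → z = 0 := by
  have hzero : ∀ z, (∀ f ∈ polydiscIdeal Y, polydiscEval z f = 0) → z ∈ Y := fun z hz =>
    (hY z).2 fun f hf => hz f (mem_polydiscIdeal.2 fun w hw => (hY w).1 hw f hf)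
  have hinv : ∀ (J : Ideal (polydiscAlg d)) (b : polydiscAlg d), polydiscIdeal Y ≤ J →
      (∀ z ∈ Y, (∀ f ∈ J, polydiscEval z f = 0) → polydiscEval z b ≠ 0) →
      ∃ u, b * u - 1 ∈ J := by
    intro J b hJ hb
    by_contra! hcon
    have hne : J ⊔ Ideal.span {b} ≠ ⊤ := by
      intro htop
      obtain ⟨j, hj, a, ha, hja⟩ :=
        Submodule.mem_sup.1 (htop ▸ Submodule.mem_top : (1 : polydiscAlg d) ∈ J ⊔ Ideal.span {b})
      obtain ⟨u, rfl⟩ := Ideal.mem_span_singleton.1 ha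
      refine hcon u ?_
      rw [← hja, sub_add_cancel_right]
      exact J.neg_mem hj
    obtain ⟨z, hz⟩ := exists_common_zero_of_ne_top hne
    refine hb z (hzero z fun f hf => hz f (Ideal.mem_sup_left (hJ hf)))
      (fun f hf => hz f (Ideal.mem_sup_left hf))
      (hz b (Ideal.mem_sup_right (Ideal.mem_span_singleton_self b)))
  obtain ⟨n, k, hnk, hk⟩ := exists_pow_mul_mem (B := polydiscAlg d) (polydiscEval 0) polydiscCoord
    ker_polydiscEval_zero (isClosed_polydiscIdeal Y) (x := x)
    (fun b hb => hinv _ b le_sup_left fun z hz hzJ => by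
      rwa [hx z hz (hzJ x (Ideal.mem_sup_right (Ideal.mem_span_singleton_self x)))]) hx0
    (fun ε hε => by
      obtain ⟨c, hc, hcY⟩ := hbd ε hε
      refine ⟨c, hc, hinv _ _ le_rfl fun z hz _ => ?_⟩
      rw [map_sub, AlgHom.commutes, sub_ne_zero]
      exact hcY z hz)
  have hk' : ∀ᶠ z in 𝓝 (0 : Polydisc d), (k : C(Polydisc d, ℂ)) z ≠ 0 := by
    refine (map_continuous (k : C(Polydisc d, ℂ))).continuousAt.eventually_ne ?_
    rw [← polydiscEval_apply, hk]
    exact one_ne_zero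
  filter_upwards [hk'] with z hzk hzY
  have := mem_polydiscIdeal.1 hnk z hzY
  rw [map_mul, map_pow] at this
  exact hx z hzY (eq_zero_of_pow_eq_zero ((mul_eq_zero.1 this).resolve_right hzk))

end Polydisc

section RepresentingMeasure

variable {E : Type*} [MetricSpace E] [CompactSpace E]

/-- The real part of a continuous complex function. -/
def reFun : C(E, ℂ) →ₗ[ℝ] C(E, ℝ) where
  toFun φ := ⟨fun z => (φ z).re, Complex.continuous_re.comp φ.continuous⟩
  map_add' _ _ := rfl
  map_smul' c φ := by
    ext z
    simp

/-- If the values of an algebra at `x` are dominated on `K`, then so are the real parts. -/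
lemma re_le_of_forall_norm_le {A : Subalgebra ℂ C(E, ℂ)} {K : Set E} {x : E}
    (h : ∀ φ ∈ A, ∀ r, 0 ≤ r → (∀ z ∈ K, ‖φ z‖ ≤ r) → ‖φ x‖ ≤ r) {φ : C(E, ℂ)} (hφ : φ ∈ A) {s : ℝ}
    (hs : ∀ z ∈ K, (φ z).re ≤ s) : (φ x).re ≤ s := by
  by_contra! hlt
  obtain ⟨c, hc⟩ := exists_gt (max (‖φ‖ + |s|) ((s ^ 2 - (φ x).re ^ 2 + ‖φ‖ ^ 2) /
    (2 * ((φ x).re - s))))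
  have hc1 := (le_max_left _ _).trans_lt hc
  have hc2 := (le_max_right _ _).trans_lt hc
  rw [div_lt_iff₀ (by linarith)] at hc2
  have hsq : ∀ z, ‖(φ + algebraMap ℂ C(E, ℂ) (c : ℂ)) z‖ ^ 2 =
      ((φ z).re + c) ^ 2 + (φ z).im ^ 2 := fun z => by
    rw [Complex.sq_norm, Complex.normSq_apply]
    simp [sq]
  have hx := h _ (A.add_mem hφ (A.algebraMap_mem (c : ℂ))) (√((s + c) ^ 2 + ‖φ‖ ^ 2))
    (Real.sqrt_nonneg _) fun z hz => by
      apply Real.le_sqrt_of_sq_le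
      rw [hsq]
      have h1 := (Complex.abs_re_le_norm (φ z)).trans (φ.norm_coe_le_norm z)
      have h2 := (Complex.abs_im_le_norm (φ z)).trans (φ.norm_coe_le_norm z)
      have h3 := abs_le.1 h1
      have h4 := sq_le_sq' (by linarith [(abs_le.1 h2).1]) (abs_le.1 h2).2
      have h5 := abs_nonneg s
      have h6 : ((φ z).re + c) ^ 2 ≤ (s + c) ^ 2 :=
        pow_le_pow_left₀ (by linarith) (by linarith [hs z hz]) 2
      linarith
  have hx2 := pow_le_pow_left₀ (norm_nonneg _) hx 2
  rw [hsq, Real.sq_sqrt (by positivity)] at hx2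
  nlinarith [sq_nonneg (φ x).im]

lemma exists_measure_of_forall_norm_le [MeasurableSpace E] [BorelSpace E]
    {A : Subalgebra ℂ C(E, ℂ)} {K : Set E} (hK : IsClosed K) {x : E}
    (h : ∀ φ ∈ A, ∀ r, 0 ≤ r → (∀ z ∈ K, ‖φ z‖ ≤ r) → ‖φ x‖ ≤ r) :
    ∃ μ : Measure E, IsFiniteMeasure μ ∧ μ.Regular ∧ (∀ φ ∈ A, φ x = ∫ z, φ z ∂μ) ∧
      μ Kᶜ = 0 := by
  have hne : K.Nonempty := by
    rw [Set.nonempty_iff_ne_empty]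
    rintro rfl
    have := h 1 A.one_mem 0 le_rfl (by simp)
    norm_num at this
  have hbdd : ∀ f : C(E, ℝ), BddAbove (f '' K) := fun f =>
    (hK.isCompact.image f.continuous).bddAbove
  have hle : ∀ (f : C(E, ℝ)), ∀ z ∈ K, f z ≤ sSup (f '' K) := fun f z hz =>
    le_csSup (hbdd f) (Set.mem_image_of_mem _ hz)
  have hsup : ∀ (f : C(E, ℝ)) (r : ℝ), (∀ z ∈ K, f z ≤ r) → sSup (f '' K) ≤ r := fun f r hr =>
    csSup_le (hne.image f) (Set.forall_mem_image.2 hr)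
  obtain ⟨g, hg, hgN⟩ := exists_extension_of_le_sublinear
    (E := C(E, ℝ)) ⟨(A.toSubmodule.restrictScalars ℝ).map reFun,
      (ContinuousMap.evalCLM ℝ x).toLinearMap.comp (Submodule.subtype _)⟩
    (fun f => sSup (f '' K))
    (fun c hc f => by
      refine le_antisymm (hsup _ _ fun z hz => ?_) ?_
      · exact mul_le_mul_of_nonneg_left (hle f z hz) hc.le
      · rw [← le_div_iff₀' hc]
        refine hsup _ _ fun z hz => ?_
        rw [le_div_iff₀' hc]
        exact hle (c • f) z hz)
    (fun f₁ f₂ => hsup _ _ fun z hz => add_le_add (hle f₁ z hz) (hle f₂ z hz))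
    (by
      rintro ⟨_, φ, hφ, rfl⟩
      exact re_le_of_forall_norm_le h hφ fun z hz => hle (reFun φ) z hz)
  have hpos : ∀ f : C(E, ℝ), (∀ z ∈ K, f z ≤ 0) → g f ≤ 0 := fun f hf =>
    (hgN f).trans (hsup f 0 hf)
  let Λ : CompactlySupportedContinuousMap E ℝ →ₚ[ℝ] ℝ := .mk₀
    { toFun f := g f
      map_add' f₁ f₂ := g.map_add f₁ f₂
      map_smul' c f := g.map_smul c f } fun f hf => by
        have := hpos (-f) fun z _ => neg_nonpos.2 (hf z)
        rw [map_neg, neg_nonpos] at this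
        exact this
  have hint : ∀ f : C(E, ℝ), ∫ z, f z ∂(RealRMK.rieszMeasure Λ) = g f := fun f =>
    RealRMK.integral_rieszMeasure Λ (CompactlySupportedContinuousMap.continuousMapEquiv f)
  have hintg : ∀ f : C(E, ℂ), Integrable f (RealRMK.rieszMeasure Λ) := fun f =>
    f.continuous.integrable_of_hasCompactSupport (.of_compactSpace f)
  have hre : ∀ φ ∈ A, (φ x).re = (∫ z, φ z ∂(RealRMK.rieszMeasure Λ)).re := fun φ hφ => by
    refine (hg ⟨_, φ, hφ, rfl⟩).symm.trans ((hint (reFun φ)).symm.trans ?_)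
    exact integral_re (hintg φ)
  refine ⟨RealRMK.rieszMeasure Λ, inferInstance, inferInstance, fun φ hφ => ?_, ?_⟩
  · refine Complex.ext (hre φ hφ) ?_
    have := hre _ (A.smul_mem hφ (-Complex.I))
    simp only [ContinuousMap.smul_apply, integral_const_mul, smul_eq_mul] at this
    simpa using this
  · let f : C(E, ℝ) := ⟨fun z => infDist z K, continuous_infDist_pt K⟩
    have hf : ∫ z, f z ∂(RealRMK.rieszMeasure Λ) = 0 := by
      refine le_antisymm ?_ (integral_nonneg fun z => infDist_nonneg)
      rw [hint]
      exact hpos f fun z hz => (infDist_zero_of_mem hz).le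
    rw [integral_eq_zero_iff_of_nonneg (f := f) (fun z => infDist_nonneg)
      (f.continuous.integrable_of_hasCompactSupport (.of_compactSpace f))] at hf
    refine measure_mono_null (fun z hz => ?_) (ae_iff.1 hf)
    exact fun hz0 => hz ((hK.mem_iff_infDist_zero hne).2 hz0)

end RepresentingMeasure

section PeakFunction

lemma countable_diff_derivedSet {E : Type*} [TopologicalSpace E] [SecondCountableTopology E]
    (X : Set E) : (X \ derivedSet X).Countable := by
  have : DiscreteTopology ↑(X \ derivedSet X) := discreteTopology_of_noAccPts fun x hx hacc =>
    hx.2 (hacc.mono (Filter.principal_mono.2 Set.sdiff_subset))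
  exact Set.countable_coe_iff.1 (TopologicalSpace.separableSpace_iff_countable.1 inferInstance)

lemma countable_setOf_exp_eq (c : ℂ) : {w : ℂ | Complex.exp w = c}.Countable := by
  rcases Set.eq_empty_or_nonempty {w : ℂ | Complex.exp w = c} with h | ⟨w₀, hw₀⟩
  · simp [h]
  · refine (Set.countable_range fun n : ℤ => w₀ + n * (2 * Real.pi * Complex.I)).mono fun w hw => ?_
    obtain ⟨n, hn⟩ := Complex.exp_eq_exp_iff_exists_int.1 (hw.trans hw₀.symm)
    exact ⟨n, hn.symm⟩

open Polynomial in
lemma countable_setOf_mul_exp_eq {d : ℕ} {v : Fin d → ℂ} (hv : v ≠ 0) (a : ℂ) {b : ℂ}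
    (hb : b ≠ 0) :
    {t : ℝ | a * Complex.exp (∑ i : Fin d, (t : ℂ) ^ (i + 1 : ℕ) * v i) = b}.Countable := by
  let P : ℂ[X] := ∑ i : Fin d, C (v i) * X ^ (i + 1 : ℕ)
  have hP : ∀ w, P - C w ≠ 0 := by
    intro w h0
    refine hv (funext fun i => ?_)
    have := congrArg (fun p => p.coeff (i + 1 : ℕ)) h0
    simpa [P, finsetSum_coeff, coeff_X_pow, coeff_C, Fin.val_inj] using this
  have hroots : ∀ w, {t : ℝ | P.eval (t : ℂ) = w}.Finite := fun w => by
    refine ((P - C w).rootSet_finite ℂ |>.preimage Complex.ofReal_injective.injOn).subset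
      fun t ht => ?_
    rw [Set.mem_preimage, mem_rootSet_of_ne (hP w)]
    simpa [sub_eq_zero] using ht
  refine ((countable_setOf_exp_eq (b / a)).biUnion fun w _ => (hroots w).countable).mono
    fun t ht => ?_
  have ha : a ≠ 0 := by
    rintro rfl
    exact hb (by simpa using ht.symm)
  refine Set.mem_iUnion₂.2 ⟨∑ i : Fin d, (t : ℂ) ^ (i + 1 : ℕ) * v i, ?_, ?_⟩
  · exact (eq_div_iff ha).2 ((mul_comm _ _).trans ht)
  · simp [P, eval_finsetSum, mul_comm (v _)]

variable {d : ℕ}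

lemma exists_isMaxOn_interior {K : Set (CB d)} (hK : IsCompact K) (φ : C(CB d, ℂ)) {r : ℝ}
    (hr : 0 ≤ r) (hφ : ∀ z ∈ K ∩ sphereD d, ‖φ z‖ ≤ r) {x : CB d} (hxK : x ∈ K)
    (hx : r < ‖φ x‖) : ∃ p ∈ K, p ∈ openD d ∧ φ p ≠ 0 ∧ ∃ ε > 0,
      IsMaxOn (fun z : CB d => ‖φ z‖ * Real.exp (ε * ‖(z : EuclideanSpace ℂ (Fin d))‖ ^ 2)) K p := by
  have hlim : Tendsto (fun ε : ℝ => r * Real.exp ε) (𝓝[>] 0) (𝓝 r) := by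
    have : Continuous fun ε : ℝ => r * Real.exp ε := by fun_prop
    simpa using (this.tendsto 0).mono_left nhdsWithin_le_nhds
  obtain ⟨ε, hεr, hε⟩ := ((hlim.eventually (gt_mem_nhds hx)).and self_mem_nhdsWithin).exists
  replace hε : 0 < ε := hε
  have hcont : Continuous fun z : CB d =>
      ‖φ z‖ * Real.exp (ε * ‖(z : EuclideanSpace ℂ (Fin d))‖ ^ 2) := by fun_prop
  obtain ⟨p, hpK, hp⟩ := hK.exists_isMaxOn ⟨x, hxK⟩ hcont.continuousOn
  have hxp : ‖φ x‖ ≤ ‖φ p‖ * Real.exp (ε * ‖(p : EuclideanSpace ℂ (Fin d))‖ ^ 2) :=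
    (le_mul_of_one_le_right (norm_nonneg _) (Real.one_le_exp (by positivity))).trans (hp hxK)
  refine ⟨p, hpK, ?_, ?_, ε, hε, hp⟩
  · by_contra hpo
    have hp1 : ‖(p : EuclideanSpace ℂ (Fin d))‖ = 1 :=
      le_antisymm (mem_closedBall_zero_iff.1 p.2) (not_lt.1 hpo)
    rw [hp1, one_pow, mul_one] at hxp
    have := mul_le_mul_of_nonneg_right (hφ p ⟨hpK, hp1⟩) (Real.exp_pos ε).le
    linarith
  · intro h0
    rw [h0, norm_zero, zero_mul] at hxp
    linarith

/-- The coordinate functions on the closed ball. -/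
def ballCoord (i : Fin d) : C(CB d, ℂ) :=
  ⟨fun z => (z : EuclideanSpace ℂ (Fin d)) i,
    (EuclideanSpace.proj (𝕜 := ℂ) i).continuous.comp continuous_subtype_val⟩

lemma ballCoord_apply (i : Fin d) (z : CB d) :
    ballCoord i z = (z : EuclideanSpace ℂ (Fin d)) i := rfl

lemma ballCoord_mem (i : Fin d) : ballCoord i ∈ ballAlgSub d :=
  Subalgebra.le_topologicalClosure _ (Algebra.subset_adjoin ⟨i, rfl⟩)

lemma exp_mem_ballAlgSub {f : C(CB d, ℂ)} (hf : f ∈ ballAlgSub d) :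
    NormedSpace.exp f ∈ ballAlgSub d :=
  NormedSpace.exp_mem (R := ℂ) (Subalgebra.isClosed_topologicalClosure _) hf

lemma exp_apply_continuousMap (f : C(CB d, ℂ)) (z : CB d) :
    NormedSpace.exp f z = Complex.exp (f z) := by
  rw [Complex.exp_eq_exp_ℂ]
  exact NormedSpace.map_exp (ContinuousMap.evalAlgHom ℂ ℂ z) (continuous_eval_const z) f

lemma norm_sq_eq_add (z p : EuclideanSpace ℂ (Fin d)) :
    ‖z‖ ^ 2 = ‖p‖ ^ 2 + 2 * (∑ i, (z i - p i) * starRingEnd ℂ (p i)).re + ‖z - p‖ ^ 2 := by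
  simp only [EuclideanSpace.norm_sq_eq, Complex.re_sum, Finset.mul_sum, ← Finset.sum_add_distrib]
  refine Finset.sum_congr rfl fun i _ => ?_
  simp only [Complex.sq_norm, Complex.normSq_apply, PiLp.sub_apply]
  simp
  ring

lemma re_sum_pow_mul_sq_le {t : ℝ} (ht0 : 0 ≤ t) (ht1 : t ≤ 1) (v : EuclideanSpace ℂ (Fin d)) :
    (∑ i : Fin d, (t : ℂ) ^ (i + 1 : ℕ) * v i ^ 2).re ≤ t * ‖v‖ ^ 2 := by
  rw [EuclideanSpace.norm_sq_eq, Finset.mul_sum, Complex.re_sum]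
  refine Finset.sum_le_sum fun i _ => (Complex.re_le_norm _).trans ?_
  rw [norm_mul, norm_pow, norm_pow, Complex.norm_real, Real.norm_of_nonneg ht0]
  gcongr
  exact pow_le_of_le_one ht0 ht1 (Nat.succ_ne_zero _)

lemma exists_exponent_mem_ballAlgSub (p : EuclideanSpace ℂ (Fin d)) (ε t : ℝ) :
    ∃ f ∈ ballAlgSub d, ∀ z : CB d, f z =
      2 * ε * ∑ i, ((z : EuclideanSpace ℂ (Fin d)) i - p i) * starRingEnd ℂ (p i) +
        ∑ i : Fin d, (t : ℂ) ^ (i + 1 : ℕ) * ((z : EuclideanSpace ℂ (Fin d)) i - p i) ^ 2 := by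
  have hcoord : ∀ i, ballCoord i - algebraMap ℂ _ (p i) ∈ ballAlgSub d := fun i =>
    sub_mem (ballCoord_mem i) ((ballAlgSub d).algebraMap_mem _)
  refine ⟨(2 * ε : ℂ) • ∑ i, starRingEnd ℂ (p i) • (ballCoord i - algebraMap ℂ _ (p i)) +
    ∑ i : Fin d, ((t : ℂ) ^ (i + 1 : ℕ)) • (ballCoord i - algebraMap ℂ _ (p i)) ^ 2,
    add_mem ((ballAlgSub d).smul_mem (sum_mem fun i _ => (ballAlgSub d).smul_mem (hcoord i) _) _)
      (sum_mem fun i _ => (ballAlgSub d).smul_mem (pow_mem (hcoord i) 2) _), fun z => ?_⟩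
  simp [ballCoord_apply, mul_comm (starRingEnd ℂ _)]

lemma mul_exp_lt_of_mul_exp_le {a b s t u : ℝ} (ha : 0 ≤ a) (hb : 0 < b)
    (hab : a * Real.exp s ≤ b * Real.exp t) (hu : u < s - t) : a * Real.exp u < b := by
  rcases ha.eq_or_lt with rfl | ha
  · simpa using hb
  · refine (mul_lt_mul_of_pos_left (Real.exp_lt_exp.2 hu) ha).trans_le ?_
    rwa [Real.exp_sub, ← mul_div_assoc, div_le_iff₀ (Real.exp_pos _)]

/-- There is a function in the ball algebra which peaks on `K` at an interior point, and which
avoids the peak value on a given countable set. -/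
lemma exists_peak_function {K N : Set (CB d)} (hK : IsCompact K) (hN : N.Countable)
    (hKN : Disjoint K N) {φ : C(CB d, ℂ)} (hφA : φ ∈ ballAlgSub d) {r : ℝ} (hr : 0 ≤ r)
    (hφ : ∀ z ∈ K ∩ sphereD d, ‖φ z‖ ≤ r) {x : CB d} (hxK : x ∈ K) (hx : r < ‖φ x‖) :
    ∃ p ∈ K, p ∈ openD d ∧ ∃ G ∈ ballAlgSub d, G p = 1 ∧ (∀ z ∈ K, z ≠ p → ‖G z‖ < 1) ∧
      ∀ z ∈ N, G z ≠ 1 := by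
  obtain ⟨p, hpK, hp, hp0, ε, hε, hmax⟩ := exists_isMaxOn_interior hK φ hr hφ hxK hx
  choose f hfA hf using exists_exponent_mem_ballAlgSub (p : EuclideanSpace ℂ (Fin d)) ε
  obtain ⟨t, htN, ht0, ht1⟩ : ∃ t : ℝ, (∀ q ∈ N, φ q * Complex.exp (f t q) ≠ φ p) ∧
      0 < t ∧ t < min 1 ε := by
    have hbad : (⋃ q ∈ N, {t : ℝ | φ q * Complex.exp (f t q) = φ p}).Countable := by
      refine hN.biUnion fun q hq => ?_
      simp only [hf, Complex.exp_add, ← mul_assoc (φ q)]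
      refine countable_setOf_mul_exp_eq (fun h => ?_) _ hp0
      have hqp : q = p := by
        ext i
        simpa [sub_eq_zero] using congrFun h i
      exact hKN.ne_of_mem hpK hq hqp.symm
    obtain ⟨t, htN, ht⟩ := (hbad.dense_compl ℝ).exists_mem_open isOpen_Ioo
      (Set.nonempty_Ioo.2 (lt_min one_pos hε))
    exact ⟨t, by simpa using htN, ht⟩
  rw [lt_min_iff] at ht1
  have hG : ∀ z, ((φ p)⁻¹ • (φ * NormedSpace.exp (f t))) z =
      (φ p)⁻¹ * (φ z * Complex.exp (f t z)) := fun z => by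
    rw [← exp_apply_continuousMap]
    rfl
  refine ⟨p, hpK, hp, (φ p)⁻¹ • (φ * NormedSpace.exp (f t)),
    (ballAlgSub d).smul_mem (mul_mem hφA (exp_mem_ballAlgSub (hfA t))) _, ?_,
    fun z hz hzp => ?_, fun z hz => ?_⟩
  · rw [hG, hf]
    simp [hp0]
  · rw [hG, norm_mul, norm_inv, inv_mul_lt_one₀ (norm_pos_iff.2 hp0), norm_mul, Complex.norm_exp]
    refine mul_exp_lt_of_mul_exp_le (norm_nonneg _) (norm_pos_iff.2 hp0) (hmax hz) ?_
    have hpos : 0 < ‖(z : EuclideanSpace ℂ (Fin d)) - (p : EuclideanSpace ℂ (Fin d))‖ ^ 2 :=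
      pow_pos (norm_pos_iff.2 (sub_ne_zero.2 (Subtype.coe_injective.ne hzp))) 2
    have hquad := re_sum_pow_mul_sq_le ht0.le ht1.1.le
      ((z : EuclideanSpace ℂ (Fin d)) - (p : EuclideanSpace ℂ (Fin d)))
    simp only [PiLp.sub_apply] at hquad
    have hlt := mul_lt_mul_of_pos_right ht1.2 hpos
    rw [hf, Complex.add_re, show (2 * ε : ℂ) = ((2 * ε : ℝ) : ℂ) by push_cast; rfl,
      Complex.re_ofReal_mul, norm_sq_eq_add (z : EuclideanSpace ℂ (Fin d)) p]
    linarith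
  · rw [hG, ne_eq, inv_mul_eq_one₀ hp0]
    exact (htN z hz).symm

end PeakFunction

section Transport

variable {d : ℕ}

lemma norm_add_smul_toLp_le (p : EuclideanSpace ℂ (Fin d)) {ρ : ℝ} (hρ : 0 ≤ ρ)
    (w : Polydisc d) : ‖p + (ρ : ℂ) • WithLp.toLp 2 (w : Fin d → ℂ)‖ ≤ ‖p‖ + ρ * √d := by
  refine (norm_add_le _ _).trans ?_
  rw [norm_smul, Complex.norm_real, Real.norm_of_nonneg hρ]
  gcongr
  rw [EuclideanSpace.norm_eq]
  refine Real.sqrt_le_sqrt ?_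
  calc ∑ i, ‖(w : Fin d → ℂ) i‖ ^ 2 ≤ ∑ _i : Fin d, (1 : ℝ) :=
        Finset.sum_le_sum fun i _ => pow_le_one₀ (norm_nonneg _) (mem_polydisc.1 w.2 i)
    _ = d := by simp

/-- The embedding of the polydisc in the ball as a small polydisc around `p`. -/
def polydiscToBall (p : EuclideanSpace ℂ (Fin d)) {ρ : ℝ} (hρ : 0 ≤ ρ)
    (h : ‖p‖ + ρ * √d ≤ 1) : C(Polydisc d, CB d) where
  toFun w := ⟨p + (ρ : ℂ) • WithLp.toLp 2 (w : Fin d → ℂ),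
    mem_closedBall_zero_iff.2 ((norm_add_smul_toLp_le p hρ w).trans h)⟩
  continuous_toFun := by
    have : Continuous fun w : Polydisc d => WithLp.toLp 2 (w : Fin d → ℂ) :=
      (PiLp.continuous_toLp 2 _).comp continuous_subtype_val
    exact (continuous_const.add (this.const_smul (ρ : ℂ))).subtype_mk _

lemma comp_polydiscToBall_mem (p : EuclideanSpace ℂ (Fin d)) {ρ : ℝ} (hρ : 0 ≤ ρ)
    (h : ‖p‖ + ρ * √d ≤ 1) {f : C(CB d, ℂ)} (hf : f ∈ ballAlgSub d) :
    f.comp (polydiscToBall p hρ h) ∈ polydiscAlg d := by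
  have hclosed : IsClosed {f : C(CB d, ℂ) | f.comp (polydiscToBall p hρ h) ∈ polydiscAlg d} :=
    isClosed_polydiscAlg.preimage (ContinuousMap.continuous_precomp (polydiscToBall p hρ h))
  suffices hpoly : ∀ f ∈ polyAlg d, f.comp (polydiscToBall p hρ h) ∈ polydiscAlg d from
    closure_minimal hpoly hclosed hf
  intro f hf
  induction hf using Algebra.adjoin_induction with
  | mem f hf =>
    obtain ⟨i, rfl⟩ := hf
    exact add_mem ((polydiscAlg d).algebraMap_mem (p i))
      ((polydiscAlg d).smul_mem (polydiscCoordFun_mem i) (ρ : ℂ))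
  | algebraMap c => exact (polydiscAlg d).algebraMap_mem c
  | add f g _ _ hf hg => exact (polydiscAlg d).add_mem hf hg
  | mul f g _ _ hf hg => exact (polydiscAlg d).mul_mem hf hg

/-- A point of a zero set at which some function of the ball algebra takes the value `1`, and
nowhere else on the zero set, is isolated if values arbitrarily close to `1` are omitted. -/
lemma not_accPt_of_isolated_value {S : Set C(CB d, ℂ)} (hS : S ⊆ ballAlg d) {p : CB d}
    (hp : p ∈ openD d) {G : C(CB d, ℂ)} (hG : G ∈ ballAlgSub d)
    (hGp : G p = 1) (hG1 : ∀ z ∈ ZS d S, G z = 1 → z = p)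
    (hbd : ∀ ε > 0, ∃ c : ℂ, ‖c‖ < ε ∧ ∀ z ∈ ZS d S, G z ≠ 1 + c) :
    ¬ AccPt p (𝓟 (ZS d S)) := by
  have hp1 : ‖(p : EuclideanSpace ℂ (Fin d))‖ < 1 := hp
  have hd : 0 < √d + 1 := by positivity
  set ρ := (1 - ‖(p : EuclideanSpace ℂ (Fin d))‖) / (√d + 1) with hρ_def
  have hρ : 0 < ρ := div_pos (by linarith) hd
  have hρ1 : ‖(p : EuclideanSpace ℂ (Fin d))‖ + ρ * √d ≤ 1 := by
    have : ρ * (√d + 1) = 1 - ‖(p : EuclideanSpace ℂ (Fin d))‖ := div_mul_cancel₀ _ hd.ne'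
    linarith
  let ι := polydiscToBall (p : EuclideanSpace ℂ (Fin d)) hρ.le hρ1
  have hι0 : ι 0 = p := by
    ext i
    change (p : EuclideanSpace ℂ (Fin d)) i + (ρ : ℂ) * 0 = _
    simp
  have hιinj : ∀ w, ι w = p → w = 0 := fun w hw => by
    ext i
    have h1 : (p : EuclideanSpace ℂ (Fin d)) i + (ρ : ℂ) * (w : Fin d → ℂ) i =
        (p : EuclideanSpace ℂ (Fin d)) i :=
      congrArg (fun z : CB d => (z : EuclideanSpace ℂ (Fin d)) i) hw
    simpa [hρ.ne'] using h1
  let J : ballAlgSub d → polydiscAlg d := fun f => ⟨_, comp_polydiscToBall_mem _ hρ.le hρ1 f.2⟩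
  have hJ : ∀ f w, polydiscEval w (J f) = (f : C(CB d, ℂ)) (ι w) := fun _ _ => rfl
  have hx : ∀ w, polydiscEval w (J ⟨G, hG⟩ - 1) = G (ι w) - 1 := fun w => by
    rw [map_sub, map_one, hJ]
  have hiso := eventually_eq_zero_of_zeroSet (S := J '' {f | (f : C(CB d, ℂ)) ∈ S})
    (Y := ι ⁻¹' ZS d S) (x := J ⟨G, hG⟩ - 1)
    (fun w => by
      rw [Set.forall_mem_image]
      exact ⟨fun hw f hf => hw _ hf, fun hw f hf => hw (x := ⟨f, hS hf⟩) hf⟩)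
    (by rw [hx, hι0, hGp, sub_self])
    (fun w hw hw1 => hιinj w (hG1 _ hw (sub_eq_zero.1 ((hx w).symm.trans hw1))))
    (fun ε hε => by
      obtain ⟨c, hc, hcG⟩ := hbd ε hε
      refine ⟨c, hc, fun w hw => ?_⟩
      rw [hx, ne_eq, sub_eq_iff_eq_add']
      exact hcG _ hw)
  obtain ⟨δ, hδ, hball⟩ := Metric.eventually_nhds_iff.1 hiso
  rw [accPt_iff_frequently, Filter.not_frequently]
  filter_upwards [Metric.ball_mem_nhds p (mul_pos hρ (lt_min hδ one_pos))] with z hz hzX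
  let v : EuclideanSpace ℂ (Fin d) := z - p
  have hv : ‖v‖ < ρ * min δ 1 := by
    rwa [Metric.mem_ball, Subtype.dist_eq, dist_eq_norm] at hz
  have hcoord : ∀ i, ‖(ρ : ℂ)⁻¹ * v i‖ < min δ 1 := fun i => by
    rw [norm_mul, norm_inv, Complex.norm_real, Real.norm_of_nonneg hρ.le, inv_mul_lt_iff₀ hρ]
    exact (PiLp.norm_apply_le v i).trans_lt hv
  let w : Polydisc d := ⟨fun i => (ρ : ℂ)⁻¹ * v i,
    mem_polydisc.2 fun i => (hcoord i).le.trans (min_le_right _ _)⟩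
  have hw : ι w = z := by
    ext i
    change (p : EuclideanSpace ℂ (Fin d)) i + (ρ : ℂ) * ((ρ : ℂ)⁻¹ * v i) = _
    rw [mul_inv_cancel_left₀ (Complex.ofReal_ne_zero.2 hρ.ne')]
    simp [v]
  have hw0 : dist w 0 < δ := by
    rw [Subtype.dist_eq]
    refine (dist_pi_lt_iff hδ).2 fun i => ?_
    exact (dist_zero_right _).trans_lt ((hcoord i).trans_le (min_le_left _ _))
  refine hzX.1 ?_
  rw [← hw, hball hw0 (by rw [Set.mem_preimage, hw]; exact hzX.2), hι0]

end Transport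

section Main

variable {d : ℕ}

lemma isClosed_ZS (S : Set C(CB d, ℂ)) : IsClosed (ZS d S) := by
  simp only [ZS, Set.ofPred_forall]
  exact isClosed_biInter fun φ _ => isClosed_eq φ.continuous continuous_const

lemma isClosed_sphereD : IsClosed (sphereD d) :=
  isClosed_eq continuous_subtype_val.norm continuous_const

lemma not_accPt_of_notMem_hatSet {S : Set C(CB d, ℂ)} (hS : S ⊆ ballAlg d) {x : CB d}
    (hx : x ∈ ZS d S \ hatSet d (ZS d S ∩ sphereD d)) : ¬ AccPt x (𝓟 (ZS d S)) := by
  intro hacc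
  have hX := isClosed_ZS S
  have hxo : x ∈ openD d :=
    (mem_closedBall_zero_iff.1 x.2).lt_of_ne fun h => hx.2 (Or.inl ⟨hx.1, h⟩)
  obtain ⟨φ, hφA, r, hr, hφ, hφx⟩ : ∃ φ ∈ ballAlgSub d, ∃ r, 0 ≤ r ∧
      (∀ z ∈ ZS d S ∩ sphereD d, ‖φ z‖ ≤ r) ∧ r < ‖φ x‖ := by
    by_contra! hcon
    obtain ⟨μ, hfin, hreg, hμ, hμ0⟩ := exists_measure_of_forall_norm_le
      (hX.inter isClosed_sphereD) hcon
    exact hx.2 (Or.inr ⟨hxo, μ, ⟨hfin, hreg, hμ⟩, hμ0⟩)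
  have hsub : derivedSet (ZS d S) ⊆ ZS d S := (isClosed_iff_derivedSet_subset _).1 hX
  obtain ⟨p, hpK, hp, G, hG, hGp, hGK, hGN⟩ := exists_peak_function
    (isClosed_derivedSet (ZS d S)).isCompact (countable_diff_derivedSet (ZS d S))
    Set.disjoint_sdiff_right hφA hr
    (fun z hz => hφ z ⟨hsub hz.1, hz.2⟩) hacc hφx
  refine not_accPt_of_isolated_value hS hp hG hGp (fun z hz hz1 => ?_)
    (fun ε hε => ?_) hpK
  · by_contra hzp
    by_cases hzK : z ∈ derivedSet (ZS d S)
    · have := hGK z hzK hzp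
      rw [hz1, norm_one] at this
      exact lt_irrefl _ this
    · exact hGN z ⟨hz, hzK⟩ hz1
  · have hbad : {c : ℝ | (1 + c : ℂ) ∈ G '' (ZS d S \ derivedSet (ZS d S))}.Countable :=
      ((countable_diff_derivedSet (ZS d S)).image G).preimage
        ((add_right_injective (1 : ℂ)).comp Complex.ofReal_injective)
    obtain ⟨c, hc, hc0, hcε⟩ := (hbad.dense_compl ℝ).exists_mem_open isOpen_Ioo
      (Set.nonempty_Ioo.2 hε)
    refine ⟨c, by rwa [Complex.norm_real, Real.norm_of_nonneg hc0.le], fun z hz hzc => ?_⟩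
    by_cases hzK : z ∈ derivedSet (ZS d S)
    · have h1 : ‖G z‖ ≤ 1 := by
        rcases eq_or_ne z p with rfl | hzp
        · rw [hGp, norm_one]
        · exact (hGK z hzK hzp).le
      rw [hzc, ← Complex.ofReal_one, ← Complex.ofReal_add, Complex.norm_real,
        Real.norm_of_nonneg (by linarith)] at h1
      linarith
    · exact hc ⟨z, ⟨hz, hzK⟩, hzc⟩

lemma isIsolatedIn_of_not_accPt {X : Set (CB d)} {x : CB d} (hx : x ∈ X)
    (h : ¬ AccPt x (𝓟 X)) : IsIsolatedIn d X x := by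
  rw [accPt_iff_frequently, Filter.not_frequently] at h
  obtain ⟨U, hU, hUo, hxU⟩ := _root_.eventually_nhds_iff.1 h
  refine ⟨hx, U, hUo, Set.Subset.antisymm (fun y hy => ?_) (Set.singleton_subset_iff.2 ⟨hxU, hx⟩)⟩
  by_contra hne
  exact hU y hy.1 ⟨hne, hy.2⟩

end Main

/-- `X \ X̂₀` is countable and consists of isolated points of `X`. -/
theorem stmt1 (d : ℕ) (hd : 1 ≤ d) (X : Set (CB d)) (hX : IsZeroSet d X) :
    (X \ hatSet d (X ∩ sphereD d)).Countable ∧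
    ∀ z ∈ X \ hatSet d (X ∩ sphereD d), IsIsolatedIn d X z := by
  obtain ⟨S, hS, rfl⟩ := hX
  refine ⟨(countable_diff_derivedSet (ZS d S)).mono ?_, fun z hz =>
    isIsolatedIn_of_not_accPt hz.1 (not_accPt_of_notMem_hatSet hS hz)⟩
  exact fun z hz => ⟨hz.1, not_accPt_of_notMem_hatSet hS hz⟩

end
end
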